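/- arXiv:2003.01918 — 2 statements merged into one kernel-verified Lean document; each statement's English description precedes it below -/
import Mathlib

section
/- Let c_n denote the number of closed Deutsch paths of length n and let H_n denote the sum of the heights of all closed Deutsch paths of length n. Then the average height H_n/c_n, divided by √n, converges to 2·√(π/3) as n → ∞; that is, H_n/(c_n·√n) → 2√(π/3). -/
open Filter Real

/-- A Deutsch path of length `n`: `a 0 = 0` and each step is either an up-step of one
unit or a down-step of arbitrary positive size. -/
def DeutschPath (n : ℕ) (a : Fin (n + 1) → ℕ) : Prop :=
  a 0 = 0 ∧ ∀ j : Fin n, a j.succ = a j.castSucc + 1 ∨ a j.succ < a j.castSucc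

/-- The set of closed Deutsch paths of length `n`. -/
def ClosedDeutsch (n : ℕ) : Set (Fin (n + 1) → ℕ) :=
  {a | DeutschPath n a ∧ a (Fin.last n) = 0}

/-- The number of closed Deutsch paths of length `n`. -/
noncomputable def c (n : ℕ) : ℕ := (ClosedDeutsch n).ncard

/-- The sum of the heights of all closed Deutsch paths of length `n`, where the height
of a path is the maximum of its values. -/
noncomputable def H (n : ℕ) : ℕ := ∑ᶠ a ∈ ClosedDeutsch n, Finset.univ.sup a

/-- The coefficient of `v ^ m` in `(v⁻¹ + 1 + v) ^ n` modulo `v ^ k = 1`; for `k = 0` this is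
the trinomial coefficient. -/
noncomputable def cyclicTrinomial (k : ℕ) : ℕ → ℤ → ℝ
  | 0, m => if (k : ℤ) ∣ m then 1 else 0
  | n + 1, m => cyclicTrinomial k n (m - 1) + cyclicTrinomial k n m + cyclicTrinomial k n (m + 1)

lemma cyclicTrinomial_neg (k n : ℕ) (m : ℤ) :
    cyclicTrinomial k n (-m) = cyclicTrinomial k n m := by
  induction n generalizing m with
  | zero => simp [cyclicTrinomial]
  | succ n ih =>
    simp only [cyclicTrinomial]
    rw [← ih (m - 1), ← ih (m + 1), ih m, show -(m - 1) = -m + 1 by ring,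
      show -(m + 1) = -m - 1 by ring]
    ring

lemma cyclicTrinomial_add_self (k n : ℕ) (m : ℤ) :
    cyclicTrinomial k n (m + k) = cyclicTrinomial k n m := by
  induction n generalizing m with
  | zero => simp [cyclicTrinomial]
  | succ n ih =>
    simp only [cyclicTrinomial]
    rw [← ih (m - 1), ← ih (m + 1), ih m, show m + k - 1 = m - 1 + k by ring,
      show m + k + 1 = m + 1 + k by ring]

lemma cyclicTrinomial_eq_zero {n : ℕ} {m : ℤ} (h : (n : ℤ) < |m|) :
    cyclicTrinomial 0 n m = 0 := by
  induction n generalizing m with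
  | zero => simp only [cyclicTrinomial]; rw [if_neg]; simp at h ⊢; exact h
  | succ n ih =>
    simp only [cyclicTrinomial]
    rw [ih, ih, ih]
    · simp
    all_goals push_cast at h; grind

lemma hasSum_cyclicTrinomial {k : ℕ} (hk : k ≠ 0) (n : ℕ) (m : ℤ) :
    HasSum (fun j : ℤ => cyclicTrinomial 0 n (m + j * k)) (cyclicTrinomial k n m) := by
  induction n generalizing m with
  | zero =>
    simp only [cyclicTrinomial]
    split_ifs with h
    · obtain ⟨d, rfl⟩ := h
      convert hasSum_ite_eq (-d) (1 : ℝ) using 2 with j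
      have : (((0 : ℕ) : ℤ) ∣ k * d + j * k) ↔ j = -d := by
        rw [Nat.cast_zero, zero_dvd_iff, mul_comm j, ← mul_add, mul_eq_zero]
        simp [hk]; grind
      simp only [this]
    · convert hasSum_zero with j
      rw [if_neg]
      rw [Nat.cast_zero, zero_dvd_iff]
      intro h'
      exact h ⟨-j, by linarith⟩
  | succ n ih =>
    simp only [cyclicTrinomial]
    convert ((ih (m - 1)).add (ih m)).add (ih (m + 1)) using 2 with j
    rw [sub_add_eq_add_sub, add_right_comm m 1]

/-- The coefficient of `v ^ (-m)` in `t * (1 - v) * (1 + v) ^ i`, where `t` is an even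
Laurent series. -/
noncomputable def binomialDifference (t : ℤ → ℝ) : ℕ → ℤ → ℝ
  | 0, m => t m - t (m + 1)
  | i + 1, m => binomialDifference t i m + binomialDifference t i (m + 1)

lemma binomialDifference_neg {t : ℤ → ℝ} (ht : ∀ m, t (-m) = t m) (i : ℕ) (m : ℤ) :
    binomialDifference t i (-m) = -binomialDifference t i (m - 1 - i) := by
  induction i generalizing m with
  | zero =>
    simp only [binomialDifference]
    rw [ht, show -m + 1 = -(m - 1) by ring, ht]
    simp
  | succ i ih =>
    simp only [binomialDifference]
    rw [ih, show -m + 1 = -(m - 1) by ring, ih]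
    push_cast
    rw [show m - 1 - ((i : ℤ) + 1) + 1 = m - 1 - i by ring,
      show m - 1 - ((i : ℤ) + 1) = m - 1 - 1 - i by ring]
    ring

lemma binomialDifference_add {t : ℤ → ℝ} {k : ℤ} (ht : ∀ m, t (m + k) = t m) (i : ℕ) (m : ℤ) :
    binomialDifference t i (m + k) = binomialDifference t i m := by
  induction i generalizing m with
  | zero =>
    simp only [binomialDifference]
    rw [ht, show m + k + 1 = m + 1 + k by ring, ht]
  | succ i ih =>
    simp only [binomialDifference]
    rw [ih, show m + k + 1 = m + 1 + k by ring, ih]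

lemma binomialDifference_eq_zero {t : ℤ → ℝ} {i : ℕ} {m : ℤ}
    (ht : ∀ l : ℕ, l ≤ i + 1 → t (m + l) = 0) : binomialDifference t i m = 0 := by
  induction i generalizing m with
  | zero =>
    have h0 := ht 0 (by simp)
    have h1 := ht 1 (by simp)
    simp_all [binomialDifference]
  | succ i ih =>
    simp only [binomialDifference]
    rw [ih fun l hl => ht l (by omega), ih fun l hl => ?_, add_zero]
    have := ht (l + 1) (by omega)
    push_cast at this
    rwa [add_assoc, add_comm 1 (l : ℤ)]

lemma binomialDifference_cyclicTrinomial_succ (k n i : ℕ) (m : ℤ) :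
    binomialDifference (cyclicTrinomial k (n + 1)) i m =
      binomialDifference (cyclicTrinomial k n) i (m - 1) +
        binomialDifference (cyclicTrinomial k n) i m +
        binomialDifference (cyclicTrinomial k n) i (m + 1) := by
  induction i generalizing m with
  | zero => simp only [binomialDifference, cyclicTrinomial]; ring_nf
  | succ i ih =>
    simp only [binomialDifference]
    rw [ih, ih]
    ring_nf

/-- The number of walks with Deutsch steps of length `n` from level `i` to level `0` inside
the strip of levels `< k - 2`. -/
noncomputable def stripCount (k n : ℕ) : ℕ → ℝ
  | 0 => binomialDifference (cyclicTrinomial k n) 0 0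
  | i + 1 => binomialDifference (cyclicTrinomial k n) i 1

lemma sum_range_stripCount (k n i : ℕ) :
    ∑ j ∈ Finset.range (i + 1), stripCount k n j =
      binomialDifference (cyclicTrinomial k n) i 0 := by
  induction i with
  | zero => simp [stripCount]
  | succ i ih =>
    rw [Finset.sum_range_succ, ih]
    simp [stripCount, binomialDifference]

lemma stripCount_succ (k n i : ℕ) :
    stripCount k (n + 1) i =
      ∑ j ∈ Finset.range i, stripCount k n j + stripCount k n (i + 1) := by
  cases i with
  | zero =>
    have h := binomialDifference_neg (cyclicTrinomial_neg k n) 0 1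
    simp only [stripCount, binomialDifference_cyclicTrinomial_succ]
    simp at h ⊢
    linarith
  | succ i =>
    rw [sum_range_stripCount]
    simp only [stripCount, binomialDifference_cyclicTrinomial_succ, binomialDifference]
    simp [add_assoc]

lemma stripCount_top (h n : ℕ) : stripCount (h + 3) n (h + 1) = 0 := by
  have h1 := binomialDifference_neg (cyclicTrinomial_neg (h + 3) n) h (-1)
  have h2 := binomialDifference_add (cyclicTrinomial_add_self (h + 3) n) h (-1 - 1 - h)
  rw [show (-1 - 1 - h + ((h + 3 : ℕ) : ℤ) : ℤ) = 1 by push_cast; ring] at h2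
  rw [neg_neg] at h1
  simp only [stripCount]
  linarith

lemma stripCount_zero {h i : ℕ} (hi : i ≤ h) :
    stripCount (h + 3) 0 i = if i = 0 then 1 else 0 := by
  cases i with
  | zero =>
    simp only [stripCount, binomialDifference, cyclicTrinomial]
    rw [if_pos (by simp), if_neg]
    · simp
    · intro hd
      have := Int.le_of_dvd (by norm_num) hd
      push_cast at this
      omega
  | succ i =>
    simp only [stripCount]
    rw [binomialDifference_eq_zero]
    · simp
    · intro l hl
      simp only [cyclicTrinomial]
      rw [if_neg]
      intro hd
      have := Int.le_of_dvd (by omega) hd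
      push_cast at this
      omega

/-- Walks with Deutsch steps of length `n` from level `i` to level `0` with height at most `h`. -/
def stripWalks (h n i : ℕ) : Set (Fin (n + 1) → ℕ) :=
  {a | a 0 = i ∧ (∀ j : Fin n, a j.succ = a j.castSucc + 1 ∨ a j.succ < a j.castSucc) ∧
    a (Fin.last n) = 0 ∧ ∀ j, a j ≤ h}

lemma stripWalks_finite (h n i : ℕ) : (stripWalks h n i).Finite :=
  (Set.finite_Iic fun _ : Fin (n + 1) => h).subset fun _ ha j => ha.2.2.2 j

lemma stripWalks_succ {h i : ℕ} (n : ℕ) (hi : i ≤ h) :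
    stripWalks h (n + 1) i =
      ⋃ j ∈ (Finset.range (h + 1)).filter fun j => j < i ∨ j = i + 1,
        (Fin.cons (α := fun _ : Fin (n + 2) => ℕ) i) '' stripWalks h n j := by
  ext a
  simp only [Set.mem_iUnion, Set.mem_image, Finset.mem_filter, Finset.mem_range, exists_prop]
  constructor
  · rintro ⟨h0, hs, hl, hb⟩
    refine ⟨a 1, ⟨by have := hb 1; omega, ?_⟩, Fin.tail a,
      ⟨rfl, fun j => hs j.succ, hl, fun j => hb j.succ⟩, ?_⟩
    · have := hs 0
      simp [h0] at this
      tauto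
    · rw [← h0]; exact Fin.cons_self_tail a
  · rintro ⟨j, ⟨hj, hji⟩, b, ⟨h0, hs, hl, hb⟩, rfl⟩
    refine ⟨rfl, fun l => ?_, ?_, fun l => ?_⟩
    · refine Fin.cases ?_ (fun l => ?_) l
      · simp [h0]; tauto
      · simpa [← Fin.succ_castSucc] using hs l
    · rw [← Fin.succ_last, Fin.cons_succ, hl]
    · refine Fin.cases ?_ (fun l => ?_) l
      · simpa
      · simpa using hb l

lemma ncard_stripWalks {h i : ℕ} (n : ℕ) (hi : i ≤ h) :
    ((stripWalks h n i).ncard : ℝ) = stripCount (h + 3) n i := by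
  induction n generalizing i with
  | zero =>
    rw [stripCount_zero hi]
    split_ifs with h0
    · have : stripWalks h 0 i = {fun _ => 0} := by
        ext a
        simp only [stripWalks, Set.mem_ofPred_eq, Set.mem_singleton_iff, funext_iff]
        simp [Fin.forall_fin_one, h0]
        grind
      simp [this]
    · have : stripWalks h 0 i = ∅ := by
        ext a
        simp [stripWalks]
        grind
      simp [this]
  | succ n ih =>
    rw [stripWalks_succ n hi, stripCount_succ]
    have hcard := Set.Finite.ncard_biUnion
      (((Finset.range (h + 1)).filter fun j => j < i ∨ j = i + 1).finite_toSet)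
      (s := fun j => Fin.cons (α := fun _ : Fin (n + 2) => ℕ) i '' stripWalks h n j)
      (fun j _ => (stripWalks_finite h n j).image _) ?_
    · simp only [Finset.mem_coe] at hcard
      rw [hcard, finsum_mem_finset_eq_sum, Nat.cast_sum]
      have hterm : ∀ j ∈ (Finset.range (h + 1)).filter fun j => j < i ∨ j = i + 1,
          ((Fin.cons (α := fun _ : Fin (n + 2) => ℕ) i '' stripWalks h n j).ncard : ℝ) =
            stripCount (h + 3) n j := fun j hj => by
        rw [Set.ncard_image_of_injective _ (Fin.cons_right_injective _)]
        exact ih (Nat.lt_succ_iff.1 (Finset.mem_range.1 (Finset.mem_filter.1 hj).1))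
      rw [Finset.sum_congr rfl hterm]
      rcases hi.eq_or_lt with rfl | hlt
      · rw [stripCount_top, add_zero]
        refine Finset.sum_congr ?_ fun _ _ => rfl
        ext j; simp; omega
      · have hins : ((Finset.range (h + 1)).filter fun j => j < i ∨ j = i + 1) =
            insert (i + 1) (Finset.range i) := by
          ext j; simp; omega
        rw [hins, Finset.sum_insert (by simp), add_comm]
    · intro j _ l _ hjl
      refine Set.disjoint_left.2 ?_
      rintro _ ⟨a, ha, rfl⟩ ⟨b, hb, hab⟩
      have := Fin.cons_right_injective _ hab
      exact hjl (by rw [← ha.1, ← hb.1, this])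

lemma ClosedDeutsch.le_index {n : ℕ} {a : Fin (n + 1) → ℕ} (ha : a ∈ ClosedDeutsch n)
    (j : Fin (n + 1)) : a j ≤ j := by
  induction j using Fin.induction with
  | zero => simp [ha.1.1]
  | succ j ih =>
    have := ha.1.2 j
    simp at ih ⊢
    omega

lemma closedDeutsch_finite (n : ℕ) : (ClosedDeutsch n).Finite :=
  (Set.finite_Iic fun _ : Fin (n + 1) => n).subset fun _ ha j =>
    (ClosedDeutsch.le_index ha j).trans (Nat.lt_succ_iff.1 j.2)

lemma sep_sup_le_eq_stripWalks (n h : ℕ) :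
    {a ∈ ClosedDeutsch n | Finset.univ.sup a ≤ h} = stripWalks h n 0 := by
  ext a
  simp [ClosedDeutsch, DeutschPath, stripWalks, Finset.sup_le_iff]
  tauto

lemma closedDeutsch_eq_stripWalks {n h : ℕ} (hn : n ≤ h) :
    ClosedDeutsch n = stripWalks h n 0 := by
  rw [← sep_sup_le_eq_stripWalks, Set.sep_eq_self_iff_mem_true.2]
  intro a ha
  exact Finset.sup_le fun j _ =>
    (ClosedDeutsch.le_index ha j).trans ((Nat.lt_succ_iff.1 j.2).trans hn)

lemma c_eq_stripCount {n h : ℕ} (hn : n ≤ h) : (c n : ℝ) = stripCount (h + 3) n 0 := by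
  rw [c, closedDeutsch_eq_stripWalks hn, ncard_stripWalks n (Nat.zero_le h)]

lemma H_eq_sum (n : ℕ) :
    (H n : ℝ) = ∑ h ∈ Finset.range n, ((c n : ℝ) - stripCount (h + 3) n 0) := by
  have hcount (h : ℕ) : (c n : ℝ) - stripCount (h + 3) n 0 =
      ∑ a ∈ (closedDeutsch_finite n).toFinset, if h < Finset.univ.sup a then 1 else 0 := by
    rw [← ncard_stripWalks n (Nat.zero_le h), ← sep_sup_le_eq_stripWalks, c,
      Set.ncard_eq_toFinset_card _ (closedDeutsch_finite n),
      Set.ncard_eq_toFinset_card _ ((closedDeutsch_finite n).subset (Set.sep_subset _ _)),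
      Finset.sum_boole, sub_eq_iff_eq_add, ← Nat.cast_add,
      ← Finset.card_filter_add_card_filter_not (s := (closedDeutsch_finite n).toFinset)
        fun a => h < Finset.univ.sup a]
    congr 3
    ext
    simp
  simp_rw [hcount]
  rw [Finset.sum_comm, H, finsum_mem_eq_finite_toFinset_sum _ (closedDeutsch_finite n)]
  push_cast
  refine Finset.sum_congr rfl fun a ha => ?_
  have ha' : Finset.univ.sup a ≤ n := Finset.sup_le fun j _ =>
    (ClosedDeutsch.le_index (by simpa using ha) j).trans (Nat.lt_succ_iff.1 j.2)
  rw [← Finset.sum_filter, Finset.sum_const, nsmul_eq_mul, mul_one]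
  have : (Finset.range n).filter (fun h => h < Finset.univ.sup a) =
      Finset.range (Finset.univ.sup a) := by
    ext h
    simp only [Finset.mem_filter, Finset.mem_range]
    omega
  rw [this, Finset.card_range]

/-- The second difference of the trinomial coefficients. -/
noncomputable def trinomialSecondDiff (n : ℕ) (m : ℤ) : ℝ :=
  cyclicTrinomial 0 n (m - 1) - 2 * cyclicTrinomial 0 n m + cyclicTrinomial 0 n (m + 1)

lemma c_eq_trinomialSecondDiff (n : ℕ) : (c n : ℝ) = -trinomialSecondDiff n 0 / 2 := by
  have h := (hasSum_cyclicTrinomial (k := n + 3) (by simp) n 0).sub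
    (hasSum_cyclicTrinomial (k := n + 3) (by simp) n 1)
  have h' := hasSum_single (f := fun j : ℤ => cyclicTrinomial 0 n (0 + j * (n + 3 : ℕ)) -
    cyclicTrinomial 0 n (1 + j * (n + 3 : ℕ))) 0 fun j hj => ?_
  · rw [c_eq_stripCount le_rfl]
    have h1 := cyclicTrinomial_neg 0 n 1
    have h2 := h.unique h'
    simp only [stripCount, binomialDifference, trinomialSecondDiff] at h2 ⊢
    simp at h1 h2 ⊢
    rw [h1, h2]
    ring
  · have hj' : (n + 3 : ℤ) ≤ |j * (n + 3 : ℕ)| := by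
      rw [abs_mul, Nat.abs_cast]
      push_cast
      exact le_mul_of_one_le_left (by positivity) (Int.one_le_abs hj)
    rw [cyclicTrinomial_eq_zero, cyclicTrinomial_eq_zero, sub_zero]
    all_goals grind

lemma hasSum_stripCount (h n : ℕ) :
    HasSum (fun j : ℕ => trinomialSecondDiff n ((j + 1) * (h + 3)))
      ((c n : ℝ) - stripCount (h + 3) n 0) := by
  have hZ := ((hasSum_cyclicTrinomial (k := h + 3) (by simp) n 0).sub
    (hasSum_cyclicTrinomial (k := h + 3) (by simp) n 1)).nat_add_neg
  rw [← hasSum_nat_add_iff' 1] at hZ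
  have h1 := cyclicTrinomial_neg 0 n 1
  have hval : -(cyclicTrinomial (h + 3) n 0 - cyclicTrinomial (h + 3) n 1 +
      (cyclicTrinomial 0 n (0 + 0 * (h + 3 : ℕ)) - cyclicTrinomial 0 n (1 + 0 * (h + 3 : ℕ))) -
      ∑ i ∈ Finset.range 1, (cyclicTrinomial 0 n (0 + i * (h + 3 : ℕ)) -
        cyclicTrinomial 0 n (1 + i * (h + 3 : ℕ)) + (cyclicTrinomial 0 n (0 + -i * (h + 3 : ℕ)) -
        cyclicTrinomial 0 n (1 + -i * (h + 3 : ℕ))))) = c n - stripCount (h + 3) n 0 := by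
    rw [c_eq_trinomialSecondDiff]
    simp only [stripCount, binomialDifference, trinomialSecondDiff]
    simp at h1 ⊢
    rw [h1]
    ring
  rw [← hval]
  refine Eq.subst (motive := fun f => HasSum f _) (funext fun j => ?_) hZ.neg
  have h2 := cyclicTrinomial_neg 0 n ((j + 1) * (h + 3))
  have h3 := cyclicTrinomial_neg 0 n ((j + 1) * (h + 3) - 1)
  rw [show -(((j : ℤ) + 1) * (h + 3)  - 1) = 1 + -(j + 1) * (h + 3) by ring] at h3
  rw [← neg_mul] at h2
  simp only [trinomialSecondDiff]
  push_cast
  rw [zero_add, zero_add, h2, h3, add_comm 1 (((j : ℤ) + 1) * (h + 3))]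
  ring

lemma abs_one_add_two_mul_cos_le {θ : ℝ} (hθ : |θ| ≤ π) :
    |1 + 2 * cos θ| ≤ 3 * exp (-θ ^ 2 / 10) := by
  have hπ : π < 3.15 := pi_lt_d2
  have hsq : θ ^ 2 ≤ π ^ 2 := sq_le_sq' (abs_le.1 hθ).1 (abs_le.1 hθ).2
  have hπ2 : π ^ 2 ≤ 10 := by nlinarith [pi_pos]
  rw [abs_le]
  constructor
  · have h1 : exp (-1) ≤ exp (-θ ^ 2 / 10) := exp_le_exp.2 (by linarith)
    have h2 : 1 / 3 ≤ exp (-1) := by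
      rw [exp_neg, ← one_div]
      exact one_div_le_one_div_of_le (exp_pos _) (by linarith [exp_one_lt_d9])
    linarith [neg_one_le_cos θ]
  · have h1 := cos_le_one_sub_mul_cos_sq hθ
    have h2 := add_one_le_exp (-θ ^ 2 / 10)
    have h3 : 2 / 10 ≤ 2 / π ^ 2 := by gcongr
    nlinarith [sq_nonneg θ]

lemma two_sub_two_mul_cos_eq (x : ℝ) : 2 - 2 * cos x = x ^ 2 * sinc (x / 2) ^ 2 := by
  have h1 : cos x = 1 - 2 * sin (x / 2) ^ 2 := by
    have := cos_two_mul (x / 2)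
    rw [show 2 * (x / 2) = x by ring] at this
    rw [this, cos_sq']
    ring
  rcases eq_or_ne x 0 with rfl | hx
  · simp
  · rw [h1, sinc_of_ne_zero (by simpa)]
    field_simp
    ring

lemma two_sub_two_mul_cos_le (x : ℝ) : 2 - 2 * cos x ≤ x ^ 2 := by
  linarith [one_sub_sq_div_two_le_cos (x := x)]

lemma cyclicTrinomial_eq_integral (n : ℕ) (m : ℤ) :
    cyclicTrinomial 0 n m =
      (2 * π)⁻¹ * ∫ θ in -π..π, (1 + 2 * cos θ) ^ n * cos (m * θ) := by
  induction n generalizing m with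
  | zero =>
    simp only [cyclicTrinomial, pow_zero, one_mul, Nat.cast_zero, zero_dvd_iff]
    split_ifs with h
    · simp [h]; field_simp; ring
    · have hm : (m : ℝ) ≠ 0 := by exact_mod_cast h
      rw [intervalIntegral.integral_comp_mul_left (f := cos) hm]
      simp [sin_int_mul_pi]
  | succ n ih =>
    simp only [cyclicTrinomial]
    rw [ih, ih, ih, ← mul_add, ← mul_add, ← intervalIntegral.integral_add,
      ← intervalIntegral.integral_add]
    · congr 2
      funext θ
      push_cast
      rw [sub_mul, add_mul, one_mul, cos_sub, cos_add]
      ring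
    all_goals exact Continuous.intervalIntegrable (by fun_prop) _ _

lemma trinomialSecondDiff_eq_integral (n : ℕ) (m : ℤ) :
    trinomialSecondDiff n m =
      -(2 * π)⁻¹ * ∫ θ in -π..π, (2 - 2 * cos θ) * (1 + 2 * cos θ) ^ n * cos (m * θ) := by
  have h : trinomialSecondDiff n m = cyclicTrinomial 0 (n + 1) m - 3 * cyclicTrinomial 0 n m := by
    simp only [trinomialSecondDiff, cyclicTrinomial]
    ring
  rw [h, cyclicTrinomial_eq_integral, cyclicTrinomial_eq_integral, mul_left_comm, ← mul_sub,
    ← intervalIntegral.integral_const_mul, ← intervalIntegral.integral_sub, neg_mul, ← mul_neg,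
    ← intervalIntegral.integral_neg]
  · congr 2
    funext θ
    ring
  all_goals exact Continuous.intervalIntegrable (by fun_prop) _ _

lemma integrable_sq_mul_exp_neg_mul_sq {b : ℝ} (hb : 0 < b) :
    MeasureTheory.Integrable fun t : ℝ => t ^ 2 * exp (-b * t ^ 2) := by
  simpa using integrable_rpow_mul_exp_neg_mul_sq hb (s := 2) (by norm_num)

/-- The local limit theorem for second differences of trinomial coefficients. -/
lemma tendsto_trinomialSecondDiff_integral {m : ℕ → ℤ} {y : ℝ}
    (hm : Tendsto (fun n : ℕ => (m n : ℝ) / √n) atTop (nhds y)) :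
    Tendsto (fun n : ℕ => n * √n / 3 ^ n * trinomialSecondDiff n (m n)) atTop
      (nhds (-(2 * π)⁻¹ * ∫ t, t ^ 2 * exp (-t ^ 2 / 3) * cos (y * t))) := by
  set F : ℕ → ℝ → ℝ := fun n => (Set.Ioc (-(π * √n)) (π * √n)).indicator fun t =>
    n * (2 - 2 * cos (t / √n)) * ((1 + 2 * cos (t / √n)) / 3) ^ n * cos (m n * (t / √n)) with hF
  have hsqrt : Tendsto (fun n : ℕ => √(n : ℝ)) atTop atTop :=
    tendsto_sqrt_atTop.comp tendsto_natCast_atTop_atTop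
  have hlim : Tendsto (fun n => ∫ t, F n t) atTop
      (nhds (∫ t, t ^ 2 * exp (-t ^ 2 / 3) * cos (y * t))) := by
    refine MeasureTheory.tendsto_integral_of_dominated_convergence
      (fun t => t ^ 2 * exp (-(1 / 10) * t ^ 2)) (fun n => ?_)
      (integrable_sq_mul_exp_neg_mul_sq (by norm_num)) (fun n => ?_) ?_
    · refine (Continuous.aestronglyMeasurable ?_).indicator measurableSet_Ioc
      fun_prop
    · refine Filter.Eventually.of_forall fun t => ?_
      simp only [hF]
      by_cases ht : t ∈ Set.Ioc (-(π * √n)) (π * √n)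
      · rw [Set.indicator_of_mem ht]
        rcases n.eq_zero_or_pos with rfl | hn
        · simp; positivity
        have hs : 0 < √(n : ℝ) := by positivity
        have hs2 : √(n : ℝ) ^ 2 = n := sq_sqrt (by positivity)
        have h1 : |t / √n| ≤ π := by
          rw [abs_div, abs_of_pos hs, div_le_iff₀ hs]
          exact abs_le.2 ⟨ht.1.le, ht.2⟩
        have h2 := abs_one_add_two_mul_cos_le h1
        rw [norm_mul, norm_mul, norm_mul, norm_pow, norm_div]
        simp only [norm_eq_abs]
        have h3 : |(n : ℝ)| * |2 - 2 * cos (t / √n)| ≤ t ^ 2 := by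
          rw [abs_of_nonneg (by positivity), abs_of_nonneg (by linarith [cos_le_one (t / √n)])]
          calc (n : ℝ) * (2 - 2 * cos (t / √n)) ≤ n * (t / √n) ^ 2 := by
                gcongr; exact two_sub_two_mul_cos_le _
            _ = t ^ 2 := by rw [div_pow, hs2]; field_simp
        have h4 : (|1 + 2 * cos (t / √n)| / |3|) ^ n ≤ exp (-(1 / 10) * t ^ 2) := by
          calc (|1 + 2 * cos (t / √n)| / |3|) ^ n ≤ exp (-(t / √n) ^ 2 / 10) ^ n := by
                gcongr
                rw [abs_of_pos (by norm_num : (0 : ℝ) < 3)]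
                linarith
            _ = exp (-(1 / 10) * t ^ 2) := by
                rw [← exp_nat_mul, div_pow, hs2]
                congr 1
                field_simp
        calc _ ≤ t ^ 2 * exp (-(1 / 10) * t ^ 2) * 1 := by
              gcongr
              exact abs_cos_le_one _
          _ = _ := mul_one _
      · rw [Set.indicator_of_notMem ht]
        simp; positivity
    · refine Filter.Eventually.of_forall fun t => ?_
      have ht0 : Tendsto (fun n : ℕ => t / √n) atTop (nhds 0) := hsqrt.const_div_atTop t
      have h1 : Tendsto (fun n : ℕ => (n : ℝ) * (2 - 2 * cos (t / √n))) atTop (nhds (t ^ 2)) := by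
        have h2 : Tendsto (fun n : ℕ => t ^ 2 * sinc (t / √n / 2) ^ 2) atTop
            (nhds (t ^ 2 * sinc (0 / 2) ^ 2)) :=
          (((continuous_sinc.tendsto _).comp (ht0.div_const 2)).pow 2).const_mul _
        rw [zero_div, sinc_zero, one_pow, mul_one] at h2
        refine h2.congr' ?_
        filter_upwards [eventually_gt_atTop 0] with n hn
        rw [two_sub_two_mul_cos_eq, div_pow, sq_sqrt (by positivity)]
        field_simp
      have h3 : Tendsto (fun n : ℕ => ((1 + 2 * cos (t / √n)) / 3) ^ n) atTop
          (nhds (exp (-t ^ 2 / 3))) := by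
        have := tendsto_one_add_pow_exp_of_tendsto
          (g := fun n : ℕ => -(2 - 2 * cos (t / √n)) / 3) (t := -t ^ 2 / 3) ?_
        · refine this.congr fun n => ?_
          congr 1
          ring
        · refine (h1.neg.div_const 3).congr fun n => ?_
          ring
      have h4 : Tendsto (fun n : ℕ => cos (m n * (t / √n))) atTop (nhds (cos (y * t))) := by
        refine (continuous_cos.tendsto _).comp ?_
        refine (hm.mul_const t).congr fun n => ?_
        ring
      refine ((h1.mul h3).mul h4).congr' ?_
      have hev : ∀ᶠ n : ℕ in atTop, |t| / π < √n := hsqrt.eventually_gt_atTop _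
      filter_upwards [hev] with n hn
      rw [div_lt_iff₀' pi_pos] at hn
      simp only [hF]
      rw [Set.indicator_of_mem]
      exact ⟨(abs_lt.1 hn).1, (abs_lt.1 hn).2.le⟩
  refine (hlim.const_mul (-(2 * π)⁻¹)).congr' ?_
  filter_upwards [eventually_gt_atTop 0] with n hn
  have hs : 0 < √(n : ℝ) := by positivity
  rw [trinomialSecondDiff_eq_integral, mul_left_comm]
  congr 1
  have hle : -(π * √n) ≤ π * √n := by have := pi_pos; linarith [mul_pos this hs]
  rw [MeasureTheory.integral_indicator measurableSet_Ioc,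
    ← intervalIntegral.integral_of_le hle,
    intervalIntegral.integral_comp_div (fun θ => (n : ℝ) * (2 - 2 * cos θ) *
      ((1 + 2 * cos θ) / 3) ^ n * cos (m n * θ)) hs.ne', smul_eq_mul, ← neg_mul,
    mul_div_cancel_right₀ _ hs.ne', mul_div_cancel_right₀ _ hs.ne',
    ← intervalIntegral.integral_const_mul, ← intervalIntegral.integral_const_mul]
  congr 1
  funext θ
  rw [div_pow]
  ring

lemma integral_exp_neg_sq_div_three_mul_cos (y : ℝ) :
    ∫ t : ℝ, exp (-t ^ 2 / 3) * cos (y * t) = √(3 * π) * exp (-(3 / 4) * y ^ 2) := by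
  have h := congrArg Complex.re (fourierIntegral_gaussian (b := 1 / 3) (by norm_num) y)
  have hpow : ((π : ℂ) / (1 / 3)) ^ (1 / 2 : ℂ) * Complex.exp (-(y : ℂ) ^ 2 / (4 * (1 / 3))) =
      ((√(3 * π) * exp (-(3 / 4) * y ^ 2) : ℝ) : ℂ) := by
    rw [sqrt_eq_rpow, Complex.ofReal_mul, Complex.ofReal_cpow (by positivity)]
    push_cast
    congr 2 <;> ring
  have hint : MeasureTheory.Integrable fun x : ℝ =>
      Complex.exp (Complex.I * y * x) * Complex.exp (-(1 / 3) * (x : ℂ) ^ 2) := by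
    refine (integrable_cexp_quadratic (b := 1 / 3) (by norm_num) (Complex.I * y) 0).congr ?_
    refine Filter.Eventually.of_forall fun x => ?_
    simp only
    rw [← Complex.exp_add]
    ring_nf
  have hre := integral_re (𝕜 := ℂ) hint
  simp only [RCLike.re_eq_complex_re] at hre
  rw [hpow, Complex.ofReal_re, ← hre] at h
  rw [← h]
  congr 1
  funext t
  have h1 : Complex.exp (-(1 / 3) * (t : ℂ) ^ 2) = ((exp (-t ^ 2 / 3) : ℝ) : ℂ) := by
    push_cast; congr 1; ring
  rw [h1, Complex.re_mul_ofReal, Complex.exp_re, mul_comm]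
  simp

lemma integrable_mul_of_abs_le_one {f g : ℝ → ℝ} (hf : MeasureTheory.Integrable f)
    (hg : Continuous g) (hg1 : ∀ t, |g t| ≤ 1) : MeasureTheory.Integrable fun t => f t * g t :=
  hf.mul_bdd hg.aestronglyMeasurable (Filter.Eventually.of_forall hg1)

lemma integral_sq_mul_exp_neg_sq_div_three_mul_cos (y : ℝ) :
    ∫ t : ℝ, t ^ 2 * exp (-t ^ 2 / 3) * cos (y * t) =
      (3 / 2 - 9 / 4 * y ^ 2) * (√(3 * π) * exp (-(3 / 4) * y ^ 2)) := by
  have hexp : (fun t : ℝ => exp (-t ^ 2 / 3)) = fun t => exp (-(1 / 3) * t ^ 2) := by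
    funext t; ring_nf
  have h0 : MeasureTheory.Integrable fun t : ℝ => exp (-t ^ 2 / 3) := by
    rw [hexp]; exact integrable_exp_neg_mul_sq (by norm_num)
  have h1 : MeasureTheory.Integrable fun t : ℝ => t * exp (-t ^ 2 / 3) := by
    convert integrable_mul_exp_neg_mul_sq (b := 1 / 3) (by norm_num) using 4; ring
  have h2 : MeasureTheory.Integrable fun t : ℝ => t ^ 2 * exp (-t ^ 2 / 3) := by
    convert integrable_sq_mul_exp_neg_mul_sq (b := 1 / 3) (by norm_num) using 4; ring
  have hc : Continuous fun t => cos (y * t) := by fun_prop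
  have hs : Continuous fun t => sin (y * t) := by fun_prop
  have h0c := integrable_mul_of_abs_le_one h0 hc fun t => abs_cos_le_one _
  have h0s := integrable_mul_of_abs_le_one h0 hs fun t => abs_sin_le_one _
  have h1c := integrable_mul_of_abs_le_one h1 hc fun t => abs_cos_le_one _
  have h2c := integrable_mul_of_abs_le_one h2 hc fun t => abs_cos_le_one _
  have hder (t : ℝ) : HasDerivAt
      (fun t => -(3 / 2) * (t * exp (-t ^ 2 / 3) * cos (y * t)) +
        9 / 4 * y * (exp (-t ^ 2 / 3) * sin (y * t)))
      (t ^ 2 * exp (-t ^ 2 / 3) * cos (y * t) -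
        (3 / 2 - 9 / 4 * y ^ 2) * (exp (-t ^ 2 / 3) * cos (y * t))) t := by
    have he : HasDerivAt (fun t : ℝ => exp (-t ^ 2 / 3)) (exp (-t ^ 2 / 3) * (-(2 * t) / 3)) t := by
      simpa using (((hasDerivAt_pow 2 t).neg).div_const 3).exp
    have hl : HasDerivAt (fun t : ℝ => y * t) y t := by simpa using (hasDerivAt_id t).const_mul y
    refine (((((hasDerivAt_id' t).mul he).mul hl.cos).const_mul (-(3 / 2))).add
      ((he.mul hl.sin).const_mul (9 / 4 * y))).congr_deriv ?_
    simp only [Pi.mul_apply]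
    ring
  have h := MeasureTheory.integral_eq_zero_of_hasDerivAt_of_integrable hder
    (h2c.sub (h0c.const_mul _)) ((h1c.const_mul _).add (h0s.const_mul _))
  rw [MeasureTheory.integral_sub h2c (h0c.const_mul _), MeasureTheory.integral_const_mul,
    integral_exp_neg_sq_div_three_mul_cos] at h
  linarith

lemma tendsto_trinomialSecondDiff {m : ℕ → ℤ} {y : ℝ}
    (hm : Tendsto (fun n : ℕ => (m n : ℝ) / √n) atTop (nhds y)) :
    Tendsto (fun n : ℕ => n * √n / 3 ^ n * trinomialSecondDiff n (m n)) atTop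
      (nhds (-(2 * π)⁻¹ * ((3 / 2 - 9 / 4 * y ^ 2) * (√(3 * π) * exp (-(3 / 4) * y ^ 2))))) := by
  rw [← integral_sq_mul_exp_neg_sq_div_three_mul_cos]
  exact tendsto_trinomialSecondDiff_integral hm

lemma tendsto_c : Tendsto (fun n : ℕ => n * √n / 3 ^ n * (c n : ℝ)) atTop
    (nhds (3 * √(3 * π) / (8 * π))) := by
  have h := (tendsto_trinomialSecondDiff (m := fun _ => 0) (y := 0) (by simp)).div_const (-2)
  convert h using 2
  · rw [c_eq_trinomialSecondDiff]; ring
  · simp; field_simp; norm_num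

lemma tendsto_trinomialSecondDiff_div_c {m : ℕ → ℤ} {y : ℝ}
    (hm : Tendsto (fun n : ℕ => (m n : ℝ) / √n) atTop (nhds y)) :
    Tendsto (fun n : ℕ => trinomialSecondDiff n (m n) / c n) atTop
      (nhds ((3 * y ^ 2 - 2) * exp (-(3 / 4) * y ^ 2))) := by
  have hpos : 0 < 3 * √(3 * π) / (8 * π) := by positivity
  have h := (tendsto_trinomialSecondDiff hm).div tendsto_c hpos.ne'
  have hval : -(2 * π)⁻¹ * ((3 / 2 - 9 / 4 * y ^ 2) * (√(3 * π) * exp (-(3 / 4) * y ^ 2))) /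
      (3 * √(3 * π) / (8 * π)) = (3 * y ^ 2 - 2) * exp (-(3 / 4) * y ^ 2) := by
    have : √(3 * π) ≠ 0 := by positivity
    field_simp
    ring
  rw [hval] at h
  refine h.congr' ?_
  filter_upwards [eventually_gt_atTop 0] with n hn
  have : (0 : ℝ) < n * √n / 3 ^ n := by positivity
  exact mul_div_mul_left _ _ this.ne'

/-- Integrating `trinomialSecondDiff` by parts twice. -/
lemma sq_mul_trinomialSecondDiff (n : ℕ) (m : ℤ) :
    (m : ℝ) ^ 2 * trinomialSecondDiff (n + 2) m =
      (2 * π)⁻¹ * ∫ θ in -π..π, (1 + 2 * cos θ) ^ n *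
        ((n + 2) * (2 - 2 * cos θ) * ((n + 1) * (2 - 2 * cos θ) - 2 * (1 + 2 * cos θ)) *
          (2 + 2 * cos θ) +
        (1 + 2 * cos θ) * ((n + 2) * (2 - 2 * cos θ) - (1 + 2 * cos θ)) * (-2 * cos θ)) *
        cos (m * θ) := by
  have hder (θ : ℝ) : HasDerivAt
      (fun θ => m * ((2 - 2 * cos θ) * (1 + 2 * cos θ) ^ (n + 2) * sin (m * θ)) +
        (1 + 2 * cos θ) ^ (n + 1) * ((n + 2) * (2 - 2 * cos θ) - (1 + 2 * cos θ)) * (-2 * sin θ) *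
          cos (m * θ))
      (m ^ 2 * ((2 - 2 * cos θ) * (1 + 2 * cos θ) ^ (n + 2) * cos (m * θ)) +
        (1 + 2 * cos θ) ^ n *
        ((n + 2) * (2 - 2 * cos θ) * ((n + 1) * (2 - 2 * cos θ) - 2 * (1 + 2 * cos θ)) *
          (2 + 2 * cos θ) +
        (1 + 2 * cos θ) * ((n + 2) * (2 - 2 * cos θ) - (1 + 2 * cos θ)) * (-2 * cos θ)) *
        cos (m * θ)) θ := by
    have hl : HasDerivAt (fun θ : ℝ => (m : ℝ) * θ) m θ := by
      simpa using (hasDerivAt_id θ).const_mul (m : ℝ)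
    have hu : HasDerivAt (fun θ : ℝ => 1 + 2 * cos θ) (2 * -sin θ) θ :=
      ((hasDerivAt_cos θ).const_mul 2).const_add 1
    have hw : HasDerivAt (fun θ : ℝ => 2 - 2 * cos θ) (-(2 * -sin θ)) θ :=
      ((hasDerivAt_cos θ).const_mul 2).const_sub 2
    refine ((((hw.mul (hu.pow (n + 2))).mul hl.sin).const_mul (m : ℝ)).add
      ((((hu.pow (n + 1)).mul ((hw.const_mul (n + 2 : ℝ)).sub hu)).mul
        ((hasDerivAt_sin θ).const_mul (-2))).mul hl.cos)).congr_deriv ?_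
    simp only [Pi.mul_apply, Pi.pow_apply, Pi.sub_apply]
    simp only [show n + 2 - 1 = n + 1 by omega, Nat.add_sub_cancel]
    push_cast
    generalize hC : cos (m * θ) = C
    generalize sin (m * θ) = S
    generalize hU : cos θ = x
    have hsq : sin θ ^ 2 = 1 - x ^ 2 := by rw [sin_sq, hU]
    generalize sin θ = s at hsq
    linear_combination (4 * (n + 2) * C * (1 + 2 * x) ^ n *
      ((n + 1) * (2 - 2 * x) - 2 * (1 + 2 * x))) * hsq
  have h := intervalIntegral.integral_eq_sub_of_hasDerivAt (a := -π) (b := π)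
    (fun θ _ => hder θ) (Continuous.intervalIntegrable (by fun_prop) _ _)
  rw [intervalIntegral.integral_add (Continuous.intervalIntegrable (by fun_prop) _ _)
    (Continuous.intervalIntegrable (by fun_prop) _ _), intervalIntegral.integral_const_mul] at h
  simp only [mul_neg, sin_neg, sin_pi, sin_int_mul_pi, mul_zero, zero_mul, neg_zero, add_zero,
    sub_zero] at h
  rw [trinomialSecondDiff_eq_integral]
  simp only [mul_neg, neg_mul] at h ⊢
  linear_combination -(2 * π)⁻¹ * h

lemma abs_le_of_mem_Icc {u N : ℝ} (hN : 1 ≤ N) (h1 : -1 ≤ u) (h3 : u ≤ 3) :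
    |N * (3 - u) * ((N - 1) * (3 - u) - 2 * u) * (1 + u) + u * (N * (3 - u) - u) * (1 - u)| ≤
      18 * (1 + N * (3 - u)) ^ 2 := by
  set X := N * (3 - u) with hX
  have hX0 : 0 ≤ X := mul_nonneg (by linarith) (by linarith)
  have hu : |u| ≤ 3 := abs_le.2 ⟨by linarith, h3⟩
  have hb1 : |(N - 1) * (3 - u) - 2 * u| ≤ X + 6 := by
    rw [abs_le]
    constructor <;> nlinarith
  have hb2 : |X - u| ≤ X + 3 := by
    rw [abs_le]
    constructor <;> linarith
  have hb3 : |1 + u| ≤ 4 := abs_le.2 ⟨by linarith, by linarith⟩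
  have hb4 : |1 - u| ≤ 2 := abs_le.2 ⟨by linarith, by linarith⟩
  calc _ ≤ |X * ((N - 1) * (3 - u) - 2 * u) * (1 + u)| + |u * (X - u) * (1 - u)| := abs_add_le _ _
    _ = X * |(N - 1) * (3 - u) - 2 * u| * |1 + u| + |u| * |X - u| * |1 - u| := by
      rw [abs_mul _ (1 + u), abs_mul X, abs_mul _ (1 - u), abs_mul u, abs_of_nonneg hX0]
    _ ≤ X * (X + 6) * 4 + 3 * (X + 3) * 2 := by gcongr
    _ ≤ 18 * (1 + X) ^ 2 := by nlinarith

lemma one_add_sq_le_exp {y : ℝ} (hy : 0 ≤ y) : (1 + y) ^ 2 ≤ 14400 * exp (y / 60) := by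
  have h := add_one_le_exp (y / 120)
  have h2 : exp (y / 60) = exp (y / 120) ^ 2 := by
    rw [← exp_nat_mul]; congr 1; push_cast; ring
  rw [h2]
  nlinarith

lemma exists_trinomialSecondDiff_le :
    ∃ C : ℝ, 0 < C ∧ ∀ n : ℕ, 3 ≤ n → ∀ m : ℤ,
      (m : ℝ) ^ 2 * |trinomialSecondDiff n m| ≤ C * 3 ^ n / √n := by
  refine ⟨18 * 14400 * √(60 * π), by positivity, fun n hn m => ?_⟩
  obtain ⟨n, rfl⟩ : ∃ l, n = l + 2 := ⟨n - 2, by omega⟩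
  have hn1 : (1 : ℝ) ≤ n := by exact_mod_cast (by omega : 1 ≤ n)
  have habs : (m : ℝ) ^ 2 * |trinomialSecondDiff (n + 2) m| =
      |(m : ℝ) ^ 2 * trinomialSecondDiff (n + 2) m| := by
    rw [abs_mul, abs_of_nonneg (sq_nonneg (m : ℝ))]
  have hint : MeasureTheory.Integrable fun θ : ℝ =>
      18 * 14400 * 3 ^ n * exp (-((n + 2) / 60) * θ ^ 2) :=
    (integrable_exp_neg_mul_sq (by positivity)).const_mul _
  have hpi : -π ≤ π := by linarith [pi_pos]
  rw [habs, sq_mul_trinomialSecondDiff, abs_mul, abs_of_pos (by positivity)]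
  have hbound : ∀ θ ∈ Set.Ioc (-π) π, ‖(1 + 2 * cos θ) ^ n *
        ((n + 2) * (2 - 2 * cos θ) * ((n + 1) * (2 - 2 * cos θ) - 2 * (1 + 2 * cos θ)) *
          (2 + 2 * cos θ) +
        (1 + 2 * cos θ) * ((n + 2) * (2 - 2 * cos θ) - (1 + 2 * cos θ)) * (-2 * cos θ)) *
        cos (m * θ)‖ ≤ 18 * 14400 * 3 ^ n * exp (-((n + 2) / 60) * θ ^ 2) := by
    intro θ hθ
    have hu := abs_one_add_two_mul_cos_le (abs_le.2 ⟨hθ.1.le, hθ.2⟩)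
    have hB := abs_le_of_mem_Icc (u := 1 + 2 * cos θ) (N := n + 2) (by linarith)
      (by linarith [neg_one_le_cos θ]) (by linarith [cos_le_one θ])
    have hw := two_sub_two_mul_cos_le θ
    have hw0 : 0 ≤ 2 - 2 * cos θ := by linarith [cos_le_one θ]
    have hE := one_add_sq_le_exp (y := (n + 2) * θ ^ 2) (by positivity)
    have hB' : |(n + 2) * (2 - 2 * cos θ) * ((n + 1) * (2 - 2 * cos θ) - 2 * (1 + 2 * cos θ)) *
          (2 + 2 * cos θ) +
        (1 + 2 * cos θ) * ((n + 2) * (2 - 2 * cos θ) - (1 + 2 * cos θ)) * (-2 * cos θ)| ≤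
        18 * (14400 * exp ((n + 2) * θ ^ 2 / 60)) := by
      calc _ ≤ 18 * (1 + ((n : ℝ) + 2) * (3 - (1 + 2 * cos θ))) ^ 2 := by
            convert hB using 2; ring
        _ ≤ 18 * (1 + ((n : ℝ) + 2) * θ ^ 2) ^ 2 := by
            have : 0 ≤ 3 - (1 + 2 * cos θ) := by linarith
            gcongr
            linarith
        _ ≤ _ := by linarith
    rw [norm_mul, norm_mul, norm_pow]
    simp only [norm_eq_abs]
    calc _ ≤ (3 * exp (-θ ^ 2 / 10)) ^ n * (18 * (14400 * exp ((n + 2) * θ ^ 2 / 60))) * 1 := by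
          gcongr
          exact abs_cos_le_one _
      _ = 18 * 14400 * 3 ^ n * exp (n * (-θ ^ 2 / 10) + (n + 2) * θ ^ 2 / 60) := by
          rw [mul_pow, ← exp_nat_mul, exp_add]; ring
      _ ≤ _ := by
          gcongr
          nlinarith [sq_nonneg θ]
  have hI : |∫ θ in -π..π, (1 + 2 * cos θ) ^ n *
        ((n + 2) * (2 - 2 * cos θ) * ((n + 1) * (2 - 2 * cos θ) - 2 * (1 + 2 * cos θ)) *
          (2 + 2 * cos θ) +
        (1 + 2 * cos θ) * ((n + 2) * (2 - 2 * cos θ) - (1 + 2 * cos θ)) * (-2 * cos θ)) *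
        cos (m * θ)| ≤ 18 * 14400 * 3 ^ n * √(60 * π / (n + 2)) := by
    calc _ ≤ ∫ θ in -π..π, 18 * 14400 * 3 ^ n * exp (-((n + 2) / 60) * θ ^ 2) :=
          intervalIntegral.norm_integral_le_of_norm_le hpi
            (Filter.Eventually.of_forall hbound) hint.intervalIntegrable
      _ ≤ ∫ θ : ℝ, 18 * 14400 * 3 ^ n * exp (-((n + 2) / 60) * θ ^ 2) := by
          rw [intervalIntegral.integral_of_le hpi]
          exact MeasureTheory.setIntegral_le_integral hint
            (Filter.Eventually.of_forall fun θ => by simp only [Pi.zero_apply]; positivity)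
      _ = _ := by
          rw [MeasureTheory.integral_const_mul, integral_gaussian]
          congr 2
          field_simp
  have h2pi : (2 * π)⁻¹ ≤ 1 := inv_le_one_of_one_le₀ (by linarith [pi_gt_three])
  calc _ ≤ 1 * (18 * 14400 * 3 ^ n * √(60 * π / (n + 2))) := by gcongr
    _ ≤ 18 * 14400 * 3 ^ (n + 2) * √(60 * π / (n + 2)) := by
        rw [one_mul]
        gcongr <;> norm_num
    _ = _ := by
        rw [sqrt_div (by positivity)]
        push_cast
        ring

open MeasureTheory Set in
lemma integral_floor_mul {q : ℕ → ℝ} (hq : Summable fun h => |q h|) {s : ℝ} (hs : 0 < s) :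
    ∫ x in Ioi (0 : ℝ), q ⌊x * s⌋₊ = s⁻¹ * ∑' h, q h := by
  have hIco (h : ℕ) : EqOn (fun x : ℝ => q ⌊x⌋₊) (fun _ => q h) (Ico (h : ℝ) (h + 1)) := by
    intro x hx
    simp only [(Nat.floor_eq_iff (h.cast_nonneg.trans hx.1)).2 hx]
  have hint (h : ℕ) : IntegrableOn (fun x : ℝ => q ⌊x⌋₊) (Ico (h : ℝ) (h + 1)) :=
    (integrableOn_const (by simp)).congr_fun (hIco h).symm measurableSet_Ico
  have hval (h : ℕ) : ∫ x in Ico (h : ℝ) (h + 1), q ⌊x⌋₊ = q h := by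
    rw [setIntegral_congr_fun measurableSet_Ico (hIco h)]
    simp
  have hnorm (h : ℕ) : ∫ x in Ico (h : ℝ) (h + 1), ‖q ⌊x⌋₊‖ = |q h| := by
    rw [setIntegral_congr_fun (g := fun _ => |q h|) measurableSet_Ico
      fun x hx => by simpa using congrArg abs (hIco h hx)]
    simp
  have hU : ⋃ h : ℕ, Ico (h : ℝ) (h + 1) = Ici 0 := by
    ext x
    simp only [mem_iUnion, mem_Ici]
    exact ⟨fun ⟨h, hx⟩ => h.cast_nonneg.trans hx.1,
      fun hx => ⟨⌊x⌋₊, Nat.floor_le hx, Nat.lt_floor_add_one x⟩⟩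
  have hdisj : Pairwise (Function.onFun Disjoint fun h : ℕ => Ico (h : ℝ) (h + 1)) := by
    intro a b hab
    simpa [Function.onFun] using
      pairwise_disjoint_Ico_add_intCast (0 : ℝ) (Nat.cast_injective.ne hab : (a : ℤ) ≠ b)
  have hI := integrableOn_iUnion_of_summable_integral_norm hint (by simpa only [hnorm] using hq)
  have hsum := hasSum_integral_iUnion (fun _ => measurableSet_Ico) hdisj hI
  simp only [hval, hU, integral_Ici_eq_integral_Ioi] at hsum
  rw [integral_comp_mul_right_Ioi (fun x => q ⌊x⌋₊) 0 hs, zero_mul, ← hsum.tsum_eq, smul_eq_mul]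

/-- The limit of `trinomialSecondDiff n m / c n` when `m / √n` tends to `y`. -/
noncomputable def heightProfile (y : ℝ) : ℝ := (3 * y ^ 2 - 2) * exp (-(3 / 4) * y ^ 2)

lemma sq_mul_abs_heightProfile_le (y : ℝ) : y ^ 2 * |heightProfile y| ≤ 32 / 3 := by
  have h := quadratic_le_exp_of_nonneg (x := 3 / 4 * y ^ 2) (by positivity)
  have h1 : |3 * y ^ 2 - 2| ≤ 3 * y ^ 2 + 2 :=
    abs_le.2 ⟨by nlinarith [sq_nonneg y], by nlinarith [sq_nonneg y]⟩
  rw [heightProfile, abs_mul, abs_of_pos (exp_pos _), neg_mul, exp_neg, ← mul_assoc,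
    ← div_eq_mul_inv, div_le_iff₀ (exp_pos _)]
  nlinarith [mul_le_mul_of_nonneg_left h1 (sq_nonneg y), sq_nonneg y]

lemma exists_trinomialSecondDiff_div_c_le :
    ∃ K : ℝ, 0 < K ∧ ∀ᶠ n : ℕ in atTop, 0 < (c n : ℝ) ∧
      ∀ m : ℤ, (m : ℝ) ^ 2 * |trinomialSecondDiff n m / c n| ≤ K * n := by
  obtain ⟨C, hC, hb⟩ := exists_trinomialSecondDiff_le
  have hL : 0 < 3 * √(3 * π) / (8 * π) := by positivity
  refine ⟨C / (3 * √(3 * π) / (8 * π) / 2), by positivity, ?_⟩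
  filter_upwards [tendsto_c.eventually (lt_mem_nhds (half_lt_self hL)), eventually_ge_atTop 3]
    with n hn hn3
  set L := 3 * √(3 * π) / (8 * π) / 2 with hLdef
  have hL' : 0 < L := by positivity
  have hn0 : (0 : ℝ) < n := by exact_mod_cast (by omega : 0 < n)
  have hs : 0 < √(n : ℝ) := sqrt_pos.2 hn0
  have hc : 0 < (c n : ℝ) := by
    by_contra h
    have : (n : ℝ) * √n / 3 ^ n * c n ≤ 0 :=
      mul_nonpos_of_nonneg_of_nonpos (by positivity) (not_lt.1 h)
    linarith
  refine ⟨hc, fun m => ?_⟩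
  rw [abs_div, abs_of_pos hc, ← mul_div_assoc, div_le_iff₀ hc]
  refine (hb n hn3 m).trans ?_
  rw [div_mul_eq_mul_div, div_mul_eq_mul_div, div_le_div_iff₀ hs hL']
  have h3 : L * 3 ^ n ≤ n * √n * c n := by
    rw [div_mul_eq_mul_div, lt_div_iff₀ (by positivity)] at hn
    exact hn.le
  nlinarith [mul_le_mul_of_nonneg_left h3 hC.le]

/-- The proportion of closed Deutsch paths of length `n` whose height exceeds `⌊x * √n⌋₊`. -/
noncomputable def heightTail (n : ℕ) (x : ℝ) : ℝ :=
  ((c n : ℝ) - stripCount (⌊x * √n⌋₊ + 3) n 0) / c n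

lemma stripCount_le_c (n h : ℕ) : stripCount (h + 3) n 0 ≤ c n := by
  rw [← ncard_stripWalks n (Nat.zero_le h), ← sep_sup_le_eq_stripWalks, c, Nat.cast_le]
  exact Set.ncard_le_ncard (Set.sep_subset _ _) (closedDeutsch_finite n)

lemma heightTail_nonneg (n : ℕ) (x : ℝ) : 0 ≤ heightTail n x :=
  div_nonneg (sub_nonneg.2 (stripCount_le_c n _)) (Nat.cast_nonneg _)

lemma stripCount_nonneg (n h : ℕ) : 0 ≤ stripCount (h + 3) n 0 := by
  rw [← ncard_stripWalks n (Nat.zero_le h)]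
  exact Nat.cast_nonneg _

lemma heightTail_le_one (n : ℕ) (x : ℝ) : heightTail n x ≤ 1 :=
  div_le_one_of_le₀ (by linarith [stripCount_nonneg n ⌊x * √n⌋₊]) (Nat.cast_nonneg _)

lemma hasSum_heightTail (n : ℕ) (x : ℝ) :
    HasSum (fun j : ℕ => trinomialSecondDiff n ((j + 1) * (⌊x * √n⌋₊ + 3)) / c n)
      (heightTail n x) :=
  (hasSum_stripCount ⌊x * √n⌋₊ n).div_const _

lemma summable_succ_sq : Summable fun j : ℕ => (((j : ℝ) + 1) ^ 2)⁻¹ := by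
  simpa using (summable_nat_add_iff 1).2 (Real.summable_nat_pow_inv.2 one_lt_two)

lemma exists_heightTail_term_le :
    ∃ K : ℝ, 0 < K ∧ ∀ᶠ n : ℕ in atTop, ∀ x : ℝ, 0 < x → ∀ j : ℕ,
      |trinomialSecondDiff n ((j + 1) * (⌊x * √n⌋₊ + 3)) / c n| ≤
        K * (x ^ 2)⁻¹ * (((j : ℝ) + 1) ^ 2)⁻¹ := by
  obtain ⟨K, hK, hb⟩ := exists_trinomialSecondDiff_div_c_le
  refine ⟨K, hK, ?_⟩
  filter_upwards [hb, eventually_gt_atTop 0] with n hn hn0 x hx j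
  have hn0 : (0 : ℝ) < n := by exact_mod_cast hn0
  have h := hn.2 ((j + 1) * (⌊x * √n⌋₊ + 3))
  push_cast at h
  set A := |trinomialSecondDiff n ((j + 1) * (⌊x * √n⌋₊ + 3)) / c n|
  have hfl : x * √n ≤ ⌊x * √n⌋₊ + 3 := by linarith [Nat.lt_floor_add_one (x * √n)]
  have hsq : x ^ 2 * n ≤ ((⌊x * √n⌋₊ : ℝ) + 3) ^ 2 := by
    calc x ^ 2 * n = (x * √n) ^ 2 := by rw [mul_pow, sq_sqrt hn0.le]
      _ ≤ _ := by gcongr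
  have h2 : (((j : ℝ) + 1) ^ 2 * x ^ 2 * A) * n ≤ K * n := by
    refine le_trans ?_ h
    calc _ = ((j : ℝ) + 1) ^ 2 * (x ^ 2 * n) * A := by ring
      _ ≤ ((j : ℝ) + 1) ^ 2 * ((⌊x * √n⌋₊ : ℝ) + 3) ^ 2 * A := by gcongr
      _ = _ := by ring
  have h3 := le_of_mul_le_mul_right h2 hn0
  rw [mul_assoc, ← mul_inv, ← div_eq_mul_inv, le_div_iff₀ (by positivity)]
  linarith

/-- The limiting tail of the height distribution, scaled by the square root of the length. -/
noncomputable def limitTail (x : ℝ) : ℝ := ∑' j : ℕ, heightProfile ((j + 1) * x)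

lemma tendsto_floor_mul_add_div (x a : ℝ) (hx : 0 < x) :
    Tendsto (fun s : ℝ => (⌊x * s⌋₊ + a) / s) atTop (nhds x) := by
  have h := (tendsto_nat_floor_mul_div_atTop hx.le).add
    (tendsto_const_nhds (x := a) |>.div_atTop tendsto_id)
  rw [add_zero] at h
  exact h.congr fun s => by simp [add_div]

lemma tendsto_sqrt_natCast : Tendsto (fun n : ℕ => √(n : ℝ)) atTop atTop :=
  tendsto_sqrt_atTop.comp tendsto_natCast_atTop_atTop

lemma tendsto_heightTail {x : ℝ} (hx : 0 < x) :
    Tendsto (fun n => heightTail n x) atTop (nhds (limitTail x)) := by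
  obtain ⟨K, -, hb⟩ := exists_heightTail_term_le
  simp only [← fun n => (hasSum_heightTail n x).tsum_eq]
  refine tendsto_tsum_of_dominated_convergence (summable_succ_sq.mul_left (K * (x ^ 2)⁻¹))
    (fun j => ?_) (hb.mono fun n hn j => hn x hx j)
  refine tendsto_trinomialSecondDiff_div_c ?_
  have h := ((tendsto_floor_mul_add_div x 3 hx).comp tendsto_sqrt_natCast).const_mul ((j : ℝ) + 1)
  refine h.congr fun n => ?_
  push_cast
  simp only [Function.comp_apply]
  ring

lemma exists_heightTail_le :
    ∃ M : ℝ, 0 < M ∧ ∀ᶠ n : ℕ in atTop, ∀ x : ℝ, 0 < x →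
      ‖heightTail n x‖ ≤ M * (1 + x ^ 2)⁻¹ := by
  obtain ⟨K, hK, hb⟩ := exists_heightTail_term_le
  set S := ∑' j : ℕ, (((j : ℝ) + 1) ^ 2)⁻¹
  have hS : 0 ≤ S := tsum_nonneg fun j => by positivity
  refine ⟨1 + K * S, by positivity, hb.mono fun n hn x hx => ?_⟩
  have h1 := heightTail_le_one n x
  have h2 : heightTail n x ≤ K * (x ^ 2)⁻¹ * S := by
    rw [← (hasSum_heightTail n x).tsum_eq, ← tsum_mul_left]
    exact (hasSum_heightTail n x).summable.tsum_le_tsum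
      (fun j => (le_abs_self _).trans (hn x hx j)) (summable_succ_sq.mul_left _)
  have h3 : x ^ 2 * heightTail n x ≤ K * S := by
    calc _ ≤ x ^ 2 * (K * (x ^ 2)⁻¹ * S) := by gcongr
      _ = K * S := by field_simp
  rw [norm_of_nonneg (heightTail_nonneg n x), ← div_eq_mul_inv, le_div_iff₀ (by positivity)]
  linarith

lemma measurable_heightTail (n : ℕ) : Measurable (heightTail n) :=
  (measurable_from_nat (f := fun h => ((c n : ℝ) - stripCount (h + 3) n 0) / c n)).comp
    (Nat.measurable_floor.comp (measurable_id.mul_const _))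

open MeasureTheory Set in
lemma tendsto_integral_heightTail :
    IntegrableOn limitTail (Ioi 0) ∧
    Tendsto (fun n => ∫ x in Ioi (0 : ℝ), heightTail n x) atTop
      (nhds (∫ x in Ioi (0 : ℝ), limitTail x)) := by
  obtain ⟨M, -, hb⟩ := exists_heightTail_le
  have hbi : Integrable (fun x : ℝ => M * (1 + x ^ 2)⁻¹) (volume.restrict (Ioi 0)) :=
    (integrable_inv_one_add_sq.const_mul M).restrict
  have hlim : ∀ᵐ x ∂volume.restrict (Ioi (0 : ℝ)),
      Tendsto (fun n => heightTail n x) atTop (nhds (limitTail x)) :=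
    (ae_restrict_iff' measurableSet_Ioi).2 (Eventually.of_forall fun x hx => tendsto_heightTail hx)
  refine ⟨hbi.mono' (aestronglyMeasurable_of_tendsto_ae atTop
    (fun n => (measurable_heightTail n).aestronglyMeasurable) hlim) ?_,
    tendsto_integral_filter_of_dominated_convergence _
      (Eventually.of_forall fun n => (measurable_heightTail n).aestronglyMeasurable)
      (hb.mono fun n hn => (ae_restrict_iff' measurableSet_Ioi).2 (Eventually.of_forall hn))
      hbi hlim⟩
  refine (ae_restrict_iff' measurableSet_Ioi).2 (Eventually.of_forall fun x hx => ?_)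
  exact le_of_tendsto (tendsto_heightTail hx).norm (hb.mono fun n hn => hn x hx)

lemma integral_heightTail {n : ℕ} (hn : 0 < n) :
    ∫ x in Set.Ioi (0 : ℝ), heightTail n x = H n / (c n * √n) := by
  have hzero : ∀ h ∉ Finset.range n, ((c n : ℝ) - stripCount (h + 3) n 0) / c n = 0 := by
    intro h hh
    rw [Finset.mem_range, not_lt] at hh
    rw [c_eq_stripCount hh, sub_self, zero_div]
  have h := integral_floor_mul (q := fun h => ((c n : ℝ) - stripCount (h + 3) n 0) / c n)
    (summable_of_ne_finset_zero fun h hh => by rw [hzero h hh, abs_zero])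
    (sqrt_pos.2 (Nat.cast_pos.2 hn))
  rw [tsum_eq_sum hzero, ← Finset.sum_div, ← H_eq_sum] at h
  rw [div_mul_eq_div_div, div_eq_inv_mul _ √(n : ℝ)]
  exact h

lemma hasDerivAt_heightProfile (a x : ℝ) :
    HasDerivAt (fun x => -2 * x * exp (-(3 / 4) * (a * x) ^ 2)) (heightProfile (a * x)) x := by
  have h1 : HasDerivAt (fun x : ℝ => -(3 / 4) * (a * x) ^ 2) (-(3 / 4) * (2 * (a * x) * a)) x := by
    simpa using (((hasDerivAt_id x).const_mul a).pow 2).const_mul (-(3 / 4))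
  have h2 := ((hasDerivAt_id x).const_mul (-2)).mul h1.exp
  refine h2.congr_deriv ?_
  simp only [heightProfile, id]
  ring

lemma abs_heightProfile_le {a x : ℝ} (ha : 0 < a) (hx : 0 < x) :
    |heightProfile (a * x)| ≤ 32 / 3 * (a ^ 2)⁻¹ * (x ^ 2)⁻¹ := by
  have h := sq_mul_abs_heightProfile_le (a * x)
  rw [mul_assoc, ← mul_inv, ← div_eq_mul_inv, le_div_iff₀ (by positivity)]
  linarith [mul_pow a x 2]

open MeasureTheory Set in
lemma integral_limitTail_Ioi {ε : ℝ} (hε : 0 < ε) :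
    ∫ x in Ioi ε, limitTail x = 2 * (ε * ∑' j : ℕ, exp (-(3 / 4) * ((j + 1) * ε) ^ 2)) := by
  have hsq : IntegrableOn (fun x : ℝ => (x ^ 2)⁻¹) (Ioi ε) := by
    have := integrableOn_Ioi_rpow_of_lt (by norm_num : (-2 : ℝ) < -1) hε
    refine this.congr_fun (fun x hx => ?_) measurableSet_Ioi
    simp [rpow_neg (hε.trans hx).le]
  have hbound (j : ℕ) : ∀ x ∈ Ioi ε, ‖heightProfile ((j + 1) * x)‖ ≤
      32 / 3 * (((j : ℝ) + 1) ^ 2)⁻¹ * (x ^ 2)⁻¹ := fun x hx =>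
    abs_heightProfile_le (by positivity) (hε.trans hx)
  have hint (j : ℕ) : IntegrableOn (fun x => heightProfile ((j + 1) * x)) (Ioi ε) := by
    refine (hsq.const_mul (32 / 3 * (((j : ℝ) + 1) ^ 2)⁻¹)).mono' ?_
      ((ae_restrict_iff' measurableSet_Ioi).2 (Eventually.of_forall (hbound j)))
    exact Continuous.aestronglyMeasurable (by unfold heightProfile; fun_prop)
  have hsum : Summable fun j : ℕ => ∫ x in Ioi ε, ‖heightProfile ((j + 1) * x)‖ := by
    refine Summable.of_nonneg_of_le (fun j => by positivity) (fun j =>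
      setIntegral_mono_on (hint j).norm (hsq.const_mul (32 / 3 * (((j : ℝ) + 1) ^ 2)⁻¹))
        measurableSet_Ioi (hbound j)) ?_
    simp only [integral_const_mul]
    exact (summable_succ_sq.mul_left _).mul_right _
  have htend (j : ℕ) : Tendsto (fun x : ℝ => -2 * x * exp (-(3 / 4) * ((j + 1) * x) ^ 2)) atTop
      (nhds 0) := by
    have h0 : Tendsto (fun x : ℝ => (-2 : ℝ) * (x * exp (-x))) atTop (nhds 0) := by
      simpa using (tendsto_pow_mul_exp_neg_atTop_nhds_zero 1).const_mul (-2)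
    refine squeeze_zero_norm' ?_ (by simpa only [norm_zero] using h0.norm)
    filter_upwards [eventually_ge_atTop (4 / 3)] with x hx
    have hx0 : 0 ≤ x := by linarith
    have hj : (1 : ℝ) ≤ j + 1 := by linarith [j.cast_nonneg (α := ℝ)]
    rw [mul_assoc, norm_mul, norm_mul (-2), norm_mul, norm_mul x, norm_of_nonneg (exp_nonneg _),
      norm_of_nonneg (exp_nonneg _)]
    gcongr
    have : x ^ 2 ≤ ((j + 1) * x) ^ 2 := by
      gcongr
      nlinarith
    nlinarith
  have hval (j : ℕ) : ∫ x in Ioi ε, heightProfile ((j + 1) * x) =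
      2 * ε * exp (-(3 / 4) * ((j + 1) * ε) ^ 2) := by
    rw [integral_Ioi_of_hasDerivAt_of_tendsto' (fun x _ => hasDerivAt_heightProfile _ x) (hint j)
      (htend j)]
    ring
  have h := hasSum_integral_of_summable_integral_norm hint hsum
  simp only [hval] at h
  rw [← mul_assoc, ← tsum_mul_left, h.tsum_eq]
  rfl

open MeasureTheory Set in
lemma tendsto_gaussian_sum :
    Tendsto (fun N : ℕ => ((N : ℝ) + 1)⁻¹ *
      ∑' j : ℕ, exp (-(3 / 4) * ((j + 1) * ((N : ℝ) + 1)⁻¹) ^ 2)) atTop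
      (nhds (∫ x in Ioi (0 : ℝ), exp (-(3 / 4) * x ^ 2))) := by
  have hsum (N : ℕ) :
      Summable fun j : ℕ => |exp (-(3 / 4) * ((j + 1) * ((N : ℝ) + 1)⁻¹) ^ 2)| := by
    refine Summable.of_nonneg_of_le (fun j => abs_nonneg _) (fun j => ?_)
      (summable_succ_sq.mul_left (4 / 3 * ((N : ℝ) + 1) ^ 2))
    rw [abs_of_pos (exp_pos _), neg_mul, exp_neg]
    have h := add_one_le_exp (3 / 4 * ((j + 1) * ((N : ℝ) + 1)⁻¹) ^ 2)
    calc _ ≤ (3 / 4 * ((j + 1) * ((N : ℝ) + 1)⁻¹) ^ 2)⁻¹ :=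
          inv_anti₀ (by positivity) (by linarith)
      _ = _ := by field_simp
  have hs : Tendsto (fun N : ℕ => (N : ℝ) + 1) atTop atTop :=
    tendsto_atTop_add_const_right _ _ tendsto_natCast_atTop_atTop
  simp only [← fun N : ℕ => integral_floor_mul (hsum N) (by positivity : (0 : ℝ) < N + 1)]
  refine tendsto_integral_filter_of_dominated_convergence (fun x => exp (-(3 / 4) * x ^ 2))
    (Eventually.of_forall fun N => ?_) (Eventually.of_forall fun N => ?_)
    (integrable_exp_neg_mul_sq (by norm_num)).restrict ?_
  · exact ((measurable_from_nat
      (f := fun j : ℕ => exp (-(3 / 4) * ((j + 1) * ((N : ℝ) + 1)⁻¹) ^ 2))).comp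
      (Nat.measurable_floor.comp (measurable_id.mul_const _))).aestronglyMeasurable
  · refine (ae_restrict_iff' measurableSet_Ioi).2 (Eventually.of_forall fun x hx => ?_)
    rw [mem_Ioi] at hx
    rw [norm_of_nonneg (exp_nonneg _), exp_le_exp]
    have h : x ≤ (⌊x * ((N : ℝ) + 1)⌋₊ + 1) * ((N : ℝ) + 1)⁻¹ := by
      rw [← div_eq_mul_inv, le_div_iff₀ (by positivity)]
      exact (Nat.lt_floor_add_one _).le
    have := pow_le_pow_left₀ hx.le h 2
    linarith
  · refine (ae_restrict_iff' measurableSet_Ioi).2 (Eventually.of_forall fun x hx => ?_)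
    have h := (tendsto_floor_mul_add_div x 1 hx).comp hs
    have hcont : Continuous fun x : ℝ => exp (-(3 / 4) * x ^ 2) := by fun_prop
    exact (hcont.tendsto x).comp h

open MeasureTheory Set in
lemma integral_limitTail : ∫ x in Ioi (0 : ℝ), limitTail x = 2 * √(π / 3) := by
  have hmono : Monotone fun N : ℕ => Ioi (((N : ℝ) + 1)⁻¹) := fun M N h =>
    Ioi_subset_Ioi (by gcongr)
  have hU : ⋃ N : ℕ, Ioi (((N : ℝ) + 1)⁻¹) = Ioi 0 := by
    ext x
    simp only [mem_iUnion, mem_Ioi]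
    refine ⟨fun ⟨N, hN⟩ => lt_trans (by positivity) hN, fun hx => ?_⟩
    simpa using exists_nat_one_div_lt hx
  have h := tendsto_setIntegral_of_monotone (f := limitTail) (μ := volume)
    (fun _ => measurableSet_Ioi) hmono (by rw [hU]; exact tendsto_integral_heightTail.1)
  rw [hU] at h
  have h2 := tendsto_gaussian_sum.const_mul 2
  simp only [← fun N : ℕ => integral_limitTail_Ioi (by positivity : (0 : ℝ) < ((N : ℝ) + 1)⁻¹)]
    at h2
  rw [tendsto_nhds_unique h h2, integral_gaussian_Ioi]
  have : π / (3 / 4) = 2 ^ 2 * (π / 3) := by ring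
  rw [this, sqrt_mul (by norm_num), sqrt_sq (by norm_num)]
  ring

theorem closed_deutsch_average_height :
    Tendsto (fun n : ℕ => (H n : ℝ) / ((c n : ℝ) * Real.sqrt n)) atTop
      (nhds (2 * Real.sqrt (Real.pi / 3))) := by
  have h := tendsto_integral_heightTail.2
  rw [integral_limitTail] at h
  refine h.congr' ?_
  filter_upwards [eventually_gt_atTop 0] with n hn
  exact integral_heightTail hn
end

section
/- Let o_n denote the number of open Deutsch paths of length n and let K_n denote the sum of the heights of all open Deutsch paths of length n. Then the average height K_n/o_n, divided by √n, converges to 2·√(π/3) as n → ∞; that is, K_n/(o_n·√n) → 2√(π/3). -/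
open Filter Real

/-- The set of open Deutsch paths of length `n`. -/
def OpenDeutsch (n : ℕ) : Set (Fin (n + 1) → ℕ) := {a | DeutschPath n a}

/-- The number of open Deutsch paths of length `n`. -/
noncomputable def o (n : ℕ) : ℕ := (OpenDeutsch n).ncard

/-- The sum of the heights of all open Deutsch paths of length `n`, where the height
of a path is the maximum of its values. -/
noncomputable def K (n : ℕ) : ℕ := ∑ᶠ a ∈ OpenDeutsch n, Finset.univ.sup a

/-- The paths of length `n` starting at `i`, with the steps of a Deutsch path, that stay
at height at most `h`. -/
def boundedPaths (h : ℕ) : (n : ℕ) → ℕ → Finset (Fin (n + 1) → ℕ)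
  | 0, i => if i ≤ h then {fun _ => i} else ∅
  | n + 1, i =>
    if i ≤ h then
      (insert (i + 1) (Finset.range i)).biUnion fun j =>
        (boundedPaths h n j).image fun a => (Fin.cons i a : Fin (n + 2) → ℕ)
    else ∅

theorem mem_boundedPaths {h n i : ℕ} {a : Fin (n + 1) → ℕ} :
    a ∈ boundedPaths h n i ↔
      (a 0 = i ∧ ∀ j : Fin n, a j.succ = a j.castSucc + 1 ∨ a j.succ < a j.castSucc) ∧
        ∀ j, a j ≤ h := by
  induction n generalizing i with
  | zero =>
    simp only [boundedPaths]
    split_ifs with hi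
    · simp only [Finset.mem_singleton, funext_iff, IsEmpty.forall_iff]
      constructor <;> rintro h' <;> simp_all [Fin.forall_fin_one]
    · simp only [Finset.notMem_empty, IsEmpty.forall_iff, false_iff]
      rintro ⟨⟨h1, -⟩, h2⟩
      exact hi (h1 ▸ h2 0)
  | succ n ih =>
    simp only [boundedPaths]
    split_ifs with hi
    · simp only [Finset.mem_biUnion, Finset.mem_image, ih, Finset.mem_insert, Finset.mem_range]
      constructor
      · rintro ⟨j, hj, b, ⟨⟨hb0, hb⟩, hbh⟩, rfl⟩
        refine ⟨⟨rfl, fun k => ?_⟩, fun k => ?_⟩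
        · refine Fin.cases ?_ (fun k => ?_) k
          · simpa [hb0] using hj
          · simpa [← Fin.succ_castSucc] using hb k
        · refine Fin.cases ?_ (fun k => ?_) k
          · simpa using hi
          · simpa using hbh k
      · rintro ⟨⟨h0, hs⟩, hh⟩
        refine ⟨a 1, ?_, Fin.tail a, ⟨⟨rfl, fun k => ?_⟩, fun k => hh _⟩, ?_⟩
        · simpa [h0] using hs 0
        · simpa [Fin.tail, ← Fin.succ_castSucc] using hs k.succ
        · rw [← h0, Fin.cons_self_tail]
    · simp only [Finset.notMem_empty, false_iff]
      rintro ⟨⟨h1, -⟩, h2⟩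
      have := h2 0
      omega

theorem boundedPaths_eq_empty {h n i : ℕ} (hi : h < i) : boundedPaths h n i = ∅ := by
  cases n <;> simp [boundedPaths, hi]

theorem card_boundedPaths_succ {h n i : ℕ} (hi : i ≤ h) :
    (boundedPaths h (n + 1) i).card =
      (boundedPaths h n (i + 1)).card + ∑ j ∈ Finset.range i, (boundedPaths h n j).card := by
  have hinj : Function.Injective fun a : Fin (n + 1) → ℕ => (Fin.cons i a : Fin (n + 2) → ℕ) :=
    Fin.cons_right_injective (α := fun _ : Fin (n + 2) => ℕ) i
  simp only [boundedPaths, if_pos hi]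
  rw [Finset.card_biUnion]
  · rw [Finset.sum_insert (by simp)]
    simp only [Finset.card_image_of_injective _ hinj]
  · intro j _ k _ hjk
    rw [Function.onFun, Finset.disjoint_left]
    simp only [Finset.mem_image, mem_boundedPaths]
    rintro _ ⟨a, ha, rfl⟩ ⟨b, hb, hba⟩
    have := hinj hba
    subst this
    exact hjk (ha.1.1.symm.trans hb.1.1)

theorem DeutschPath.apply_le {n : ℕ} {a : Fin (n + 1) → ℕ} (ha : DeutschPath n a)
    (j : Fin (n + 1)) : a j ≤ j := by
  induction j using Fin.induction with
  | zero => simp [ha.1]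
  | succ j ih =>
    have := ha.2 j
    simp only [Fin.val_castSucc, Fin.val_succ] at ih ⊢
    omega

theorem openDeutsch_eq_coe_boundedPaths (n : ℕ) :
    OpenDeutsch n = (boundedPaths n n 0 : Set (Fin (n + 1) → ℕ)) := by
  ext a
  simp only [OpenDeutsch, Set.mem_ofPred_eq, Finset.mem_coe, mem_boundedPaths]
  exact ⟨fun ha => ⟨ha, fun j => (ha.apply_le j).trans (by omega)⟩, fun ha => ha.1⟩

theorem o_eq_card_boundedPaths (n : ℕ) : o n = (boundedPaths n n 0).card := by
  rw [o, openDeutsch_eq_coe_boundedPaths, Set.ncard_coe_finset]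

theorem K_eq_sum_card_boundedPaths (n : ℕ) :
    (K n : ℝ) = ∑ h ∈ Finset.range n, ((o n : ℝ) - (boundedPaths h n 0).card) := by
  have hsup : ∀ a ∈ boundedPaths n n 0, Finset.univ.sup a =
      ∑ h ∈ Finset.range n, if h < Finset.univ.sup a then 1 else 0 := by
    intro a ha
    have hle : Finset.univ.sup a ≤ n := Finset.sup_le fun j _ => (mem_boundedPaths.1 ha).2 j
    rw [← Finset.card_filter]
    have : (Finset.range n).filter (fun h => h < Finset.univ.sup a) =
        Finset.range (Finset.univ.sup a) := by
      ext; simp only [Finset.mem_filter, Finset.mem_range]; omega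
    rw [this, Finset.card_range]
  have hfilter : ∀ h ∈ Finset.range n,
      (boundedPaths n n 0).filter (fun a => ¬ h < Finset.univ.sup a) = boundedPaths h n 0 := by
    intro h hh
    ext a
    simp only [Finset.mem_filter, mem_boundedPaths, not_lt, Finset.sup_le_iff, Finset.mem_univ,
      true_imp_iff]
    rw [Finset.mem_range] at hh
    exact ⟨fun ⟨h1, h2⟩ => ⟨h1.1, h2⟩, fun ⟨h1, h2⟩ => ⟨⟨h1, fun j => (h2 j).trans hh.le⟩, h2⟩⟩
  rw [K, openDeutsch_eq_coe_boundedPaths, finsum_mem_coe_finset, Finset.sum_congr rfl hsup,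
    Finset.sum_comm, Nat.cast_sum]
  refine Finset.sum_congr rfl fun h hh => ?_
  rw [← Finset.card_filter, ← hfilter h hh, o_eq_card_boundedPaths, eq_sub_iff_add_eq]
  exact_mod_cast Finset.card_filter_add_card_filter_not _

open PowerSeries in
/-- The generating function `∑ X ^ e` over the `e` such that `H` divides `e + 2`. -/
noncomputable def dvdSeries (H : ℕ) : PowerSeries ℝ :=
  PowerSeries.mk fun e => if H ∣ e + 2 then 1 else 0

open PowerSeries in
theorem dvdSeries_mul (h : ℕ) :
    dvdSeries (h + 3) * (1 - X ^ (h + 3)) = X ^ (h + 1) := by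
  ext e
  rw [mul_sub, mul_one, map_sub, coeff_mul_X_pow', coeff_X_pow]
  simp only [dvdSeries, coeff_mk]
  by_cases he : h + 3 ≤ e
  · obtain ⟨k, rfl⟩ := Nat.exists_eq_add_of_le he
    rw [if_pos he, if_neg (show ¬ h + 3 + k = h + 1 by omega), Nat.add_sub_cancel_left,
      show h + 3 + k + 2 = h + 3 + (k + 2) by ring]
    simp only [Nat.dvd_add_right (dvd_refl _), sub_self]
  · rw [if_neg he, sub_zero]
    refine if_congr ⟨fun hd => ?_, fun hd => ⟨1, by omega⟩⟩ rfl rfl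
    obtain ⟨c, hc⟩ := hd
    have h1 : c < 2 := by
      by_contra! h2
      nlinarith
    interval_cases c <;> omega

open PowerSeries in
theorem kernel_identity (h i : ℕ) (hi : i ≤ h) :
    (1 + X + X ^ 2 : PowerSeries ℝ) * ((1 + X) ^ i * (1 - X ^ (h + 1 - i))) =
      X * ((1 + X) ^ (i + 1) * (1 - X ^ (h - i)) +
        ∑ j ∈ Finset.range i, (1 + X) ^ j * (1 - X ^ (h + 1 - j))) + (1 - X ^ (h + 3)) := by
  induction i with
  | zero => simp; ring
  | succ i ih =>
    specialize ih (by omega)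
    obtain ⟨k, rfl⟩ := Nat.exists_eq_add_of_le hi
    rw [Finset.sum_range_succ]
    rw [show i + 1 + k + 1 - i = k + 2 by omega, show i + 1 + k - i = k + 1 by omega] at ih
    rw [show i + 1 + k + 1 - i = k + 2 by omega, show i + 1 + k - (i + 1) = k by omega,
      show i + 1 + k + 1 - (i + 1) = k + 1 by omega]
    linear_combination ih

/-- The trinomial coefficient: the coefficient of `X ^ j` in `(X⁻¹ + 1 + X) ^ n`. -/
def trinom : ℕ → ℤ → ℝ
  | 0, j => if j = 0 then 1 else 0
  | n + 1, j => trinom n (j - 1) + trinom n j + trinom n (j + 1)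

theorem trinom_zero (j : ℤ) : trinom 0 j = if j = 0 then 1 else 0 := rfl

theorem trinom_succ (n : ℕ) (j : ℤ) :
    trinom (n + 1) j = trinom n (j - 1) + trinom n j + trinom n (j + 1) := rfl

theorem trinom_eq_zero {n : ℕ} {j : ℤ} (hj : (n : ℤ) < |j|) : trinom n j = 0 := by
  induction n generalizing j with
  | zero => simp_all [trinom_zero]
  | succ n ih =>
    push_cast at hj
    rw [trinom_succ, ih, ih, ih] <;> grind

theorem trinom_neg (n : ℕ) (j : ℤ) : trinom n (-j) = trinom n j := by
  induction n generalizing j with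
  | zero => simp [trinom_zero]
  | succ n ih =>
    rw [trinom_succ, trinom_succ, ← ih (j - 1), ← ih (j + 1), ih j]
    ring_nf

open PowerSeries in
theorem coeff_pow_eq_trinom (n k : ℕ) :
    coeff k ((1 + X + X ^ 2 : PowerSeries ℝ) ^ n) = trinom n (k - n) := by
  induction n generalizing k with
  | zero => simp [coeff_one, trinom_zero]
  | succ n ih =>
    rw [pow_succ, mul_add, mul_add, mul_one, map_add, map_add, ih, trinom_succ]
    have h1 : coeff k ((1 + X + X ^ 2 : PowerSeries ℝ) ^ n * X) = trinom n (k - n - 1) := by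
      cases k with
      | zero => rw [coeff_zero_mul_X, trinom_eq_zero]; grind
      | succ k => rw [coeff_succ_mul_X, ih]; push_cast; ring_nf
    have h2 : coeff k ((1 + X + X ^ 2 : PowerSeries ℝ) ^ n * X ^ 2) = trinom n (k - n - 2) := by
      rw [coeff_mul_X_pow']
      split_ifs with hk
      · rw [ih, Nat.cast_sub hk]; push_cast; ring_nf
      · rw [trinom_eq_zero]; grind
    rw [h1, h2]
    push_cast
    ring_nf

open PowerSeries in
theorem coeff_pow_mul_X_pow (n k e : ℕ) :
    coeff k ((1 + X + X ^ 2 : PowerSeries ℝ) ^ n * X ^ e) = trinom n (k - n - e) := by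
  rw [coeff_mul_X_pow']
  split_ifs with hk
  · rw [coeff_pow_eq_trinom, Nat.cast_sub hk]; ring_nf
  · rw [trinom_eq_zero]; grind

open PowerSeries in
/-- The cardinality of `boundedPaths` by Lagrange inversion, where
`(1 + X ^ 2 * dvdSeries (h + 3)) * (1 - X ^ (h + 3)) = 1`. -/
theorem card_boundedPaths (h n i : ℕ) (hi : i ≤ h + 1) :
    ((boundedPaths h n i).card : ℝ) = coeff n ((1 + X + X ^ 2 : PowerSeries ℝ) ^ n *
      ((1 - X ^ 2) * ((1 + X) ^ i * (1 - X ^ (h + 1 - i)) *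
        (1 + X ^ 2 * dvdSeries (h + 3))))) := by
  have hinv : (1 + X ^ 2 * dvdSeries (h + 3)) * (1 - X ^ (h + 3)) = 1 := by
    linear_combination X ^ 2 * dvdSeries_mul h
  induction n generalizing i with
  | zero =>
    rcases hi.eq_or_lt with rfl | hi'
    · simp [boundedPaths]
    · simp [boundedPaths, Nat.lt_succ_iff.1 hi', show h + 1 - i ≠ 0 by omega]
  | succ n ih =>
    rcases hi.eq_or_lt with rfl | hi'
    · simp [boundedPaths_eq_empty]
    · have hi' := Nat.lt_succ_iff.1 hi'
      rw [card_boundedPaths_succ hi', Nat.cast_add, Nat.cast_sum, ih _ (by omega),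
        Finset.sum_congr rfl fun j hj => ih j (by rw [Finset.mem_range] at hj; omega),
        ← map_sum, ← map_add, ← coeff_succ_mul_X]
      rw [show (1 + X + X ^ 2 : PowerSeries ℝ) ^ (n + 1) *
          ((1 - X ^ 2) * ((1 + X) ^ i * (1 - X ^ (h + 1 - i)) *
          (1 + X ^ 2 * dvdSeries (h + 3)))) =
        (1 + X + X ^ 2) ^ n * ((1 - X ^ 2) * (1 + X ^ 2 * dvdSeries (h + 3))) *
          ((1 + X + X ^ 2) * ((1 + X) ^ i * (1 - X ^ (h + 1 - i)))) by ring,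
        kernel_identity h i hi', Nat.add_sub_add_right]
      have h0 : coeff (n + 1) ((1 + X + X ^ 2 : PowerSeries ℝ) ^ n * (1 - X ^ 2)) = 0 := by
        rw [mul_sub, mul_one, map_sub, coeff_pow_mul_X_pow, coeff_pow_eq_trinom,
          ← trinom_neg n]
        push_cast
        ring_nf
      rw [← sub_eq_zero, ← map_sub, ← neg_eq_zero, ← map_neg, ← h0]
      congr 1
      have hS : ∑ j ∈ Finset.range i, (1 + X + X ^ 2 : PowerSeries ℝ) ^ n *
          ((1 - X ^ 2) * ((1 + X) ^ j * (1 - X ^ (h + 1 - j)) *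
            (1 + X ^ 2 * dvdSeries (h + 3)))) =
          (1 + X + X ^ 2) ^ n * ((1 - X ^ 2) * (1 + X ^ 2 * dvdSeries (h + 3))) *
          ∑ j ∈ Finset.range i, (1 + X) ^ j * (1 - X ^ (h + 1 - j)) := by
        rw [Finset.mul_sum]
        exact Finset.sum_congr rfl fun j _ => by ring
      rw [hS]
      linear_combination (1 + X + X ^ 2) ^ n * (1 - X ^ 2) * hinv

open PowerSeries in
theorem coeff_pow_mul_dvdSeries (n H : ℕ) :
    coeff n ((1 + X + X ^ 2 : PowerSeries ℝ) ^ n * (1 - X ^ 2) ^ 2 * dvdSeries H) =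
      ∑ q ∈ Finset.range (n + 1), if H ∣ q + 2 then
        trinom n q - 2 * trinom n (q + 2) + trinom n (q + 4) else 0 := by
  rw [mul_comm, coeff_mul, Finset.Nat.sum_antidiagonal_eq_sum_range_succ_mk]
  refine Finset.sum_congr rfl fun q hq => ?_
  have hq : q ≤ n := Nat.lt_succ_iff.1 (Finset.mem_range.1 hq)
  rw [show (1 + X + X ^ 2 : PowerSeries ℝ) ^ n * (1 - X ^ 2) ^ 2 =
    (1 + X + X ^ 2) ^ n - (1 + X + X ^ 2) ^ n * X ^ 2 - (1 + X + X ^ 2) ^ n * X ^ 2 +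
      (1 + X + X ^ 2) ^ n * X ^ 4 by ring]
  simp only [map_add, map_sub, coeff_pow_mul_X_pow, coeff_pow_eq_trinom, dvdSeries, coeff_mk]
  have e1 : ((n - q : ℕ) : ℤ) - n = -q := by omega
  rw [e1, ← trinom_neg n q, ← trinom_neg n (q + 2), ← trinom_neg n (q + 4)]
  split_ifs
  · push_cast; ring_nf
  · simp

open PowerSeries in
theorem card_boundedPaths_zero (h n : ℕ) :
    ((boundedPaths h n 0).card : ℝ) = trinom n 0 - trinom n 2 -
      ∑ q ∈ Finset.range (n + 1), if h + 3 ∣ q + 2 then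
        trinom n q - 2 * trinom n (q + 2) + trinom n (q + 4) else 0 := by
  have hQ := dvdSeries_mul h
  rw [card_boundedPaths h n 0 (by omega), ← coeff_pow_mul_dvdSeries]
  have h0 : trinom n 0 - trinom n 2 =
      coeff n ((1 + X + X ^ 2 : PowerSeries ℝ) ^ n * (1 - X ^ 2)) := by
    rw [mul_sub, mul_one, map_sub, coeff_pow_mul_X_pow, coeff_pow_eq_trinom, ← trinom_neg n 2]
    push_cast
    ring_nf
  rw [h0, ← map_sub]
  congr 1
  rw [tsub_zero, pow_zero]
  linear_combination (1 + X + X ^ 2) ^ n * (1 - X ^ 2) * hQ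

theorem trinom_nonneg (n : ℕ) (j : ℤ) : 0 ≤ trinom n j := by
  induction n generalizing j with
  | zero => rw [trinom_zero]; split_ifs <;> norm_num
  | succ n ih => rw [trinom_succ]; linarith [ih (j - 1), ih j, ih (j + 1)]

theorem trinom_add_one_le (n : ℕ) {j : ℤ} (hj : 0 ≤ j) : trinom n (j + 1) ≤ trinom n j := by
  induction n generalizing j with
  | zero =>
    rw [trinom_zero, if_neg (by omega)]
    exact trinom_nonneg 0 j
  | succ n ih =>
    rw [trinom_succ, trinom_succ, add_sub_cancel_right]
    have h1 := ih (j := j + 1) (by omega)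
    rcases hj.eq_or_lt with rfl | hj
    · have h2 := trinom_neg n 1
      simp only [zero_add, zero_sub] at *
      linarith
    · have h2 := ih (j := j) (by omega)
      have h3 := ih (j := j - 1) (by omega)
      rw [sub_add_cancel] at h3
      linarith

/-- Comparison of coefficients in `X d/dX (X⁻¹ + 1 + X) ^ (n + 1)`. -/
theorem mul_trinom_succ (n : ℕ) (j : ℤ) :
    j * trinom (n + 1) j = (n + 1) * (trinom n (j - 1) - trinom n (j + 1)) := by
  induction n generalizing j with
  | zero =>
    simp only [trinom_succ, trinom_zero]
    by_cases h1 : j = 1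
    · subst h1; norm_num
    by_cases h2 : j = -1
    · subst h2; norm_num
    by_cases h3 : j = 0
    · subst h3; norm_num
    rw [if_neg (by omega), if_neg (by omega), if_neg (by omega)]
    simp
  | succ n ih =>
    have h1 := ih (j - 1)
    have h2 := ih j
    have h3 := ih (j + 1)
    rw [trinom_succ (n + 1)]
    rw [trinom_succ n (j - 1), trinom_succ n (j + 1)] at *
    push_cast at *
    simp only [sub_add_cancel, add_sub_cancel_right] at *
    linear_combination h1 + h2 + h3

theorem o_eq_trinom (n : ℕ) : (o n : ℝ) = trinom n 0 - trinom n 2 := by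
  rw [o_eq_card_boundedPaths, card_boundedPaths_zero, sub_eq_self]
  refine Finset.sum_eq_zero fun q hq => if_neg fun hd => ?_
  have := Nat.le_of_dvd (by omega) hd
  rw [Finset.mem_range] at hq
  omega

theorem succ_mul_o (n : ℕ) : ((n : ℝ) + 1) * o n = trinom (n + 1) 1 := by
  have := mul_trinom_succ n 1
  norm_num at this
  rw [o_eq_trinom, this]

theorem card_divisors_eq_sum (n q : ℕ) (hq : q ≤ n) :
    ((Nat.divisors (q + 2)).card : ℝ) =
      ∑ h ∈ Finset.range n, (if h + 3 ∣ q + 2 then (1 : ℝ) else 0) + (if 2 ∣ q then 1 else 0) +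
        1 := by
  have h1 : (Nat.divisors (q + 2)) = (Finset.range (n + 3)).filter (· ∣ q + 2) := by
    ext k
    simp only [Nat.mem_divisors, Finset.mem_filter, Finset.mem_range]
    refine ⟨fun h => ⟨?_, h.1⟩, fun h => ⟨h.2, by omega⟩⟩
    have := Nat.le_of_dvd (by omega) h.1
    omega
  rw [h1, Finset.card_filter, Nat.cast_sum, Finset.sum_range_succ', Finset.sum_range_succ',
    Finset.sum_range_succ']
  simp

theorem sum_trinom_second_difference (n : ℕ) :
    ∑ q ∈ Finset.range (n + 1), (trinom n q - 2 * trinom n (q + 2) + trinom n (q + 4)) =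
      trinom n 0 + trinom n 1 - trinom n 2 - trinom n 3 := by
  have h := Finset.sum_range_sub' (fun q : ℕ =>
    trinom n q + trinom n (q + 1) - trinom n (q + 2) - trinom n (q + 3)) (n + 1)
  have e : trinom n (n + 1) = 0 ∧ trinom n (n + 1 + 1) = 0 ∧ trinom n (n + 1 + 2) = 0 ∧
    trinom n (n + 1 + 3) = 0 := by
    refine ⟨?_, ?_, ?_, ?_⟩ <;> apply trinom_eq_zero <;> grind
  push_cast at h
  rw [e.1, e.2.1, e.2.2.1, e.2.2.2] at h
  simp only [sub_zero, add_zero] at h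
  rw [← h]
  refine Finset.sum_congr rfl fun q _ => ?_
  ring_nf

theorem sum_trinom_second_difference_even (n : ℕ) :
    ∑ q ∈ Finset.range (n + 1),
      (if 2 ∣ q then trinom n q - 2 * trinom n (q + 2) + trinom n (q + 4) else 0) =
      trinom n 0 - trinom n 2 := by
  have h := Finset.sum_range_sub' (fun q : ℕ =>
    if 2 ∣ q then trinom n q - trinom n (q + 2) else trinom n (q + 1) - trinom n (q + 3)) (n + 1)
  have e : trinom n (n + 1) = 0 ∧ trinom n (n + 1 + 1) = 0 ∧ trinom n (n + 1 + 2) = 0 ∧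
    trinom n (n + 1 + 3) = 0 := by
    refine ⟨?_, ?_, ?_, ?_⟩ <;> apply trinom_eq_zero <;> grind
  push_cast at h
  rw [e.1, e.2.1, e.2.2.1, e.2.2.2] at h
  simp only [sub_zero, ite_self] at h
  rw [← h]
  refine Finset.sum_congr rfl fun q _ => ?_
  by_cases hq : 2 ∣ q
  · rw [if_pos hq, if_pos hq, if_neg (by omega)]
    ring_nf
  · rw [if_neg hq, if_neg hq, if_pos (by omega)]
    ring_nf

theorem succ_mul_second_difference (n : ℕ) (q : ℤ) :
    ((n : ℝ) + 1) * (trinom n q - 2 * trinom n (q + 2) + trinom n (q + 4)) =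
      (q + 1) * trinom (n + 1) (q + 1) - (q + 3) * trinom (n + 1) (q + 3) := by
  have h1 := mul_trinom_succ n (q + 1)
  have h2 := mul_trinom_succ n (q + 3)
  rw [show q + 1 - 1 = q by ring, show q + 1 + 1 = q + 2 by ring] at h1
  rw [show q + 3 - 1 = q + 2 by ring, show q + 3 + 1 = q + 4 by ring] at h2
  push_cast at h1 h2
  linear_combination h2 - h1

theorem succ_mul_K (n : ℕ) :
    ((n : ℝ) + 1) * K n =
      ∑ k ∈ Finset.range (n + 2), ((Nat.divisors (k + 1)).card : ℝ) *
        (k * trinom (n + 1) k - (k + 2) * trinom (n + 1) (k + 2)) - 2 * trinom (n + 1) 1 := by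
  have hK : (K n : ℝ) + (trinom n 0 + trinom n 1 - trinom n 2 - trinom n 3) +
      (trinom n 0 - trinom n 2) = ∑ q ∈ Finset.range (n + 1),
      ((Nat.divisors (q + 2)).card : ℝ) *
        (trinom n q - 2 * trinom n (q + 2) + trinom n (q + 4)) := by
    have h1 : ∀ h ∈ Finset.range n, (o n : ℝ) - (boundedPaths h n 0).card =
        ∑ q ∈ Finset.range (n + 1), if h + 3 ∣ q + 2 then
          trinom n q - 2 * trinom n (q + 2) + trinom n (q + 4) else 0 := fun h _ => by
      rw [o_eq_trinom, card_boundedPaths_zero, sub_sub_cancel]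
    rw [K_eq_sum_card_boundedPaths, Finset.sum_congr rfl h1, Finset.sum_comm,
      ← sum_trinom_second_difference, ← sum_trinom_second_difference_even,
      ← Finset.sum_add_distrib, ← Finset.sum_add_distrib]
    refine Finset.sum_congr rfl fun q hq => ?_
    rw [card_divisors_eq_sum n q (Nat.lt_succ_iff.1 (Finset.mem_range.1 hq)), add_mul, add_mul,
      Finset.sum_mul]
    simp only [ite_mul, one_mul, zero_mul]
    ring
  have h1 := mul_trinom_succ n 1
  have h2 := mul_trinom_succ n 2
  norm_num at h1 h2
  have hsum : ∑ q ∈ Finset.range (n + 1), ((n : ℝ) + 1) * (((Nat.divisors (q + 2)).card : ℝ) *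
        (trinom n q - 2 * trinom n (q + 2) + trinom n (q + 4))) =
      ∑ q ∈ Finset.range (n + 1), ((Nat.divisors (q + 1 + 1)).card : ℝ) *
        (((q + 1 : ℕ) : ℝ) * trinom (n + 1) (q + 1 : ℕ) -
          ((q + 1 : ℕ) + 2) * trinom (n + 1) ((q + 1 : ℕ) + 2)) := by
    refine Finset.sum_congr rfl fun q _ => ?_
    have := succ_mul_second_difference n q
    push_cast at this ⊢
    rw [show (q : ℤ) + 1 + 2 = q + 3 by ring]
    linear_combination ((Nat.divisors (q + 2)).card : ℝ) * this
  rw [Finset.sum_range_succ', ← hsum, ← Finset.mul_sum, ← hK]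
  norm_num
  linear_combination 2 * h1 + h2

/-- Silverman–Toeplitz: regular averages of a null sequence tend to zero. -/
theorem tendsto_sum_mul_of_tendsto_zero {W : ℕ → ℕ → ℝ} {L : ℕ → ℕ} {u : ℕ → ℝ} {C : ℝ}
    (hC : ∀ n, ∑ m ∈ Finset.range (L n), |W n m| ≤ C)
    (hW : ∀ m, Tendsto (fun n => W n m) atTop (nhds 0)) (hu : Tendsto u atTop (nhds 0)) :
    Tendsto (fun n => ∑ m ∈ Finset.range (L n), W n m * u m) atTop (nhds 0) := by
  have hC0 : 0 ≤ C := (Finset.sum_nonneg fun m _ => abs_nonneg (W 0 m)).trans (hC 0)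
  rw [Metric.tendsto_atTop]
  intro ε hε
  obtain ⟨M, hM⟩ := Metric.tendsto_atTop.1 hu (ε / (2 * (C + 1))) (by positivity)
  have hfin : Tendsto (fun n => ∑ m ∈ Finset.range M, |W n m| * |u m|) atTop (nhds 0) := by
    have := tendsto_finsetSum (Finset.range M) fun m _ => ((hW m).abs).mul_const |u m|
    simpa using this
  obtain ⟨n₀, hn₀⟩ := Metric.tendsto_atTop.1 hfin (ε / 2) (by positivity)
  refine ⟨n₀, fun n hn => ?_⟩
  have h1 := hn₀ n hn
  rw [Real.dist_eq, sub_zero] at h1 ⊢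
  have h2 : ∀ m ∈ Finset.range (L n), |W n m * u m| ≤
      |W n m| * (ε / (2 * (C + 1))) + if m < M then |W n m| * |u m| else 0 := by
    intro m _
    rw [abs_mul]
    split_ifs with hm
    · have : 0 ≤ |W n m| * (ε / (2 * (C + 1))) := by positivity
      linarith
    · have := hM m (by omega)
      rw [Real.dist_eq, sub_zero] at this
      rw [add_zero]
      gcongr
  have h3 : ∑ m ∈ Finset.range (L n), (if m < M then |W n m| * |u m| else 0) ≤
      ∑ m ∈ Finset.range M, |W n m| * |u m| := by
    rw [← Finset.sum_filter]
    refine Finset.sum_le_sum_of_subset_of_nonneg (fun m hm => ?_) fun _ _ _ => by positivity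
    exact Finset.mem_range.2 (Finset.mem_filter.1 hm).2
  have h4 : (∑ m ∈ Finset.range (L n), |W n m|) * (ε / (2 * (C + 1))) ≤ ε / 2 := by
    calc _ ≤ C * (ε / (2 * (C + 1))) := by gcongr; exact hC n
      _ ≤ ε / 2 := by
        rw [mul_div_assoc', div_le_div_iff₀ (by positivity) (by positivity)]
        nlinarith
  calc _ ≤ ∑ m ∈ Finset.range (L n), |W n m * u m| := Finset.abs_sum_le_sum_abs _ _
    _ ≤ _ := Finset.sum_le_sum h2
    _ < ε := by
      rw [Finset.sum_add_distrib, ← Finset.sum_mul]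
      have := lt_of_abs_lt h1
      linarith

theorem sum_Ioc_sqrt_div (N : ℕ) :
    ∑ a ∈ Finset.Ioc N.sqrt N, N / a = ∑ b ∈ Finset.Ioc 0 N.sqrt, (N / b - N.sqrt) := by
  have h1 : ∀ a ∈ Finset.Ioc N.sqrt N,
      N / a = ∑ b ∈ Finset.Ioc 0 N.sqrt, if b * a ≤ N then 1 else 0 := by
    intro a ha
    rw [Finset.mem_Ioc] at ha
    rw [← Finset.card_filter]
    have : (Finset.Ioc 0 N.sqrt).filter (fun b => b * a ≤ N) = Finset.Ioc 0 (N / a) := by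
      ext b
      simp only [Finset.mem_filter, Finset.mem_Ioc, Nat.le_div_iff_mul_le (by omega : 0 < a)]
      refine ⟨fun h => ⟨h.1.1, h.2⟩, fun h => ⟨⟨h.1, ?_⟩, h.2⟩⟩
      by_contra! hb
      have := Nat.lt_succ_sqrt N
      have : (N.sqrt + 1) * (N.sqrt + 1) ≤ b * a := Nat.mul_le_mul hb ha.1
      simp only [Nat.succ_eq_add_one] at *
      omega
    rw [this, Nat.card_Ioc, Nat.sub_zero]
  have h2 : ∀ b ∈ Finset.Ioc 0 N.sqrt,
      N / b - N.sqrt = ∑ a ∈ Finset.Ioc N.sqrt N, if b * a ≤ N then 1 else 0 := by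
    intro b hb
    rw [Finset.mem_Ioc] at hb
    rw [← Finset.card_filter]
    have : (Finset.Ioc N.sqrt N).filter (fun a => b * a ≤ N) = Finset.Ioc N.sqrt (N / b) := by
      ext a
      simp only [Finset.mem_filter, Finset.mem_Ioc, Nat.le_div_iff_mul_le (by omega : 0 < b),
        mul_comm b a]
      exact ⟨fun h => ⟨h.1.1, h.2⟩, fun h => ⟨⟨h.1, by nlinarith⟩, h.2⟩⟩
    rw [this, Nat.card_Ioc]
  rw [Finset.sum_congr rfl h1, Finset.sum_congr rfl h2, Finset.sum_comm]

/-- The Dirichlet hyperbola method for the divisor function. -/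
theorem sum_Ioc_div_eq (N : ℕ) :
    ((∑ a ∈ Finset.Ioc 0 N, N / a : ℕ) : ℝ) =
      2 * ∑ b ∈ Finset.Ioc 0 N.sqrt, ((N / b : ℕ) : ℝ) - (N.sqrt : ℝ) ^ 2 := by
  have h : ∀ b ∈ Finset.Ioc 0 N.sqrt, ((N / b - N.sqrt : ℕ) : ℝ) = (N / b : ℕ) - N.sqrt := by
    intro b hb
    rw [Finset.mem_Ioc] at hb
    refine Nat.cast_sub ((Nat.le_div_iff_mul_le hb.1).2 ?_)
    exact (Nat.mul_le_mul_left _ hb.2).trans (Nat.sqrt_le N)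
  rw [← Finset.Ioc_union_Ioc_eq_Ioc (Nat.zero_le _) (Nat.sqrt_le_self N),
    Finset.sum_union (Finset.Ioc_disjoint_Ioc_of_le le_rfl), sum_Ioc_sqrt_div]
  push_cast
  rw [Finset.sum_congr rfl h, Finset.sum_sub_distrib]
  simp
  ring

theorem abs_sum_divisors_sub_le (N : ℕ) :
    |∑ k ∈ Finset.range N, ((Nat.divisors (k + 1)).card : ℝ) -
      (2 * (N * (harmonic N.sqrt : ℝ)) - (N.sqrt : ℝ) ^ 2)| ≤ 2 * (N.sqrt : ℝ) := by
  have h1 : ∑ k ∈ Finset.range N, ((Nat.divisors (k + 1)).card : ℝ) =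
      ((∑ a ∈ Finset.Ioc 0 N, N / a : ℕ) : ℝ) := by
    rw [← ArithmeticFunction.sum_Ioc_sigma0_eq_sum_div]
    rw [Finset.range_eq_Ico, Finset.sum_Ico_add' (fun k => ((Nat.divisors k).card : ℝ)) 0 N 1]
    push_cast
    refine Finset.sum_congr (by ext; simp; omega) fun k _ => ?_
    rw [ArithmeticFunction.sigma_zero_apply]
  have h2 : |∑ b ∈ Finset.Ioc 0 N.sqrt, ((N / b : ℕ) : ℝ) - N * (harmonic N.sqrt : ℝ)| ≤
      (N.sqrt : ℝ) := by
    have h3 : (N : ℝ) * (harmonic N.sqrt : ℝ) = ∑ b ∈ Finset.Ioc 0 N.sqrt, (N : ℝ) / b := by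
      rw [harmonic_eq_sum_Icc]
      push_cast
      rw [Finset.mul_sum]
      rfl
    rw [h3, ← Finset.sum_sub_distrib]
    refine (Finset.abs_sum_le_sum_abs _ _).trans ?_
    calc _ ≤ ∑ b ∈ Finset.Ioc 0 N.sqrt, (1 : ℝ) := by
          refine Finset.sum_le_sum fun b hb => ?_
          have h4 := Nat.floor_div_eq_div (K := ℝ) N b
          have h5 := Nat.floor_le (show 0 ≤ (N : ℝ) / b by positivity)
          have h6 := Nat.lt_floor_add_one ((N : ℝ) / b)
          rw [h4] at h5 h6
          rw [abs_le]
          constructor <;> linarith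
      _ = N.sqrt := by simp
  rw [h1, sum_Ioc_div_eq]
  rw [abs_le] at h2 ⊢
  constructor <;> linarith [h2.1, h2.2]

/-- The remainder in the approximation `∑_{k ≤ N} d(k) ≈ N H_N + (γ - 1) N`. -/
noncomputable def divisorRemainder (N : ℕ) : ℝ :=
  ∑ k ∈ Finset.range N, ((Nat.divisors (k + 1)).card : ℝ) -
    (N * (harmonic N : ℝ) + (eulerMascheroniConstant - 1) * N)

theorem tendsto_sqrt_atTop_nat : Tendsto Nat.sqrt atTop atTop :=
  tendsto_atTop_atTop.2 fun b => ⟨b * b, fun _ h => Nat.le_sqrt.2 h⟩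

theorem tendsto_nat_sqrt_div : Tendsto (fun N : ℕ => (N.sqrt : ℝ) / N) atTop (nhds 0) := by
  have h1 : Tendsto (fun N : ℕ => ((N.sqrt : ℝ))⁻¹) atTop (nhds 0) :=
    tendsto_inv_atTop_zero.comp (tendsto_natCast_atTop_atTop.comp tendsto_sqrt_atTop_nat)
  refine squeeze_zero' (Eventually.of_forall fun N => by positivity) ?_ h1
  filter_upwards [eventually_ge_atTop 1] with N hN
  have h2 : (0 : ℝ) < N.sqrt := by exact_mod_cast Nat.sqrt_pos.2 hN
  have h3 : (N.sqrt : ℝ) * N.sqrt ≤ N := by exact_mod_cast Nat.sqrt_le N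
  rw [inv_eq_one_div, div_le_div_iff₀ (by positivity) h2]
  linarith

theorem tendsto_nat_sqrt_sq_div :
    Tendsto (fun N : ℕ => (N.sqrt : ℝ) ^ 2 / N) atTop (nhds 1) := by
  have h1 : Tendsto (fun N : ℕ => 1 - 3 * ((N.sqrt : ℝ) / N)) atTop (nhds 1) := by
    simpa using (tendsto_nat_sqrt_div.const_mul 3).const_sub 1
  refine tendsto_of_tendsto_of_tendsto_of_le_of_le' h1 tendsto_const_nhds ?_ ?_
  · filter_upwards [eventually_ge_atTop 1] with N hN
    have h2 : (1 : ℝ) ≤ N.sqrt := by exact_mod_cast Nat.sqrt_pos.2 hN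
    have h3 : (N : ℝ) ≤ (N.sqrt + 1) * (N.sqrt + 1) := by exact_mod_cast (Nat.lt_succ_sqrt N).le
    have h4 : (0 : ℝ) < N := by exact_mod_cast hN
    rw [le_div_iff₀ h4, sub_mul, mul_assoc, div_mul_cancel₀ _ h4.ne']
    nlinarith
  · refine Eventually.of_forall fun N => div_le_one_of_le₀ ?_ (by positivity)
    exact_mod_cast Nat.sqrt_le' N

theorem tendsto_divisorRemainder_div :
    Tendsto (fun N : ℕ => divisorRemainder N / N) atTop (nhds 0) := by
  set γ := eulerMascheroniConstant with hγ
  have hH := tendsto_harmonic_sub_log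
  have hlog : Tendsto (fun N : ℕ => log ((N.sqrt : ℝ) ^ 2 / N)) atTop (nhds 0) := by
    have := (continuousAt_log one_ne_zero).tendsto.comp tendsto_nat_sqrt_sq_div
    rwa [log_one] at this
  have hmain : Tendsto (fun N : ℕ => 2 * ((harmonic N.sqrt : ℝ) - log N.sqrt) -
      ((harmonic N : ℝ) - log N) + log ((N.sqrt : ℝ) ^ 2 / N) - (N.sqrt : ℝ) ^ 2 / N - (γ - 1))
      atTop (nhds 0) := by
    have := (((((hH.comp tendsto_sqrt_atTop_nat).const_mul 2).sub hH).add hlog).sub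
      tendsto_nat_sqrt_sq_div).sub_const (γ - 1)
    rwa [show 2 * γ - γ + 0 - 1 - (γ - 1) = 0 by ring] at this
  have hdiff : Tendsto (fun N : ℕ => divisorRemainder N / N -
      (2 * ((harmonic N.sqrt : ℝ) - log N.sqrt) -
      ((harmonic N : ℝ) - log N) + log ((N.sqrt : ℝ) ^ 2 / N) - (N.sqrt : ℝ) ^ 2 / N - (γ - 1)))
      atTop (nhds 0) := by
    have h2 := tendsto_nat_sqrt_div.const_mul 2
    rw [mul_zero] at h2
    refine squeeze_zero_norm' ?_ h2
    filter_upwards [eventually_ge_atTop 1] with N hN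
    have h3 : (0 : ℝ) < N := by exact_mod_cast hN
    have h4 : (0 : ℝ) < N.sqrt := by exact_mod_cast Nat.sqrt_pos.2 hN
    rw [log_div (by positivity) h3.ne', log_pow, Real.norm_eq_abs, mul_div_assoc',
      le_div_iff₀ h3, ← abs_of_pos h3, ← abs_mul, abs_of_pos h3]
    refine (le_of_eq (congrArg abs ?_)).trans (abs_sum_divisors_sub_le N)
    rw [divisorRemainder]
    field_simp
    push_cast
    ring
  simpa using hdiff.add hmain

theorem card_divisors_eq (k : ℕ) :
    ((Nat.divisors (k + 1)).card : ℝ) = (harmonic k : ℝ) + eulerMascheroniConstant +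
      (divisorRemainder (k + 1) - divisorRemainder k) := by
  rw [divisorRemainder, divisorRemainder, Finset.sum_range_succ, harmonic_succ]
  push_cast
  field_simp
  ring

theorem integral_cos_int_mul (j : ℤ) :
    ∫ θ in (-π)..π, cos (j * θ) = if j = 0 then 2 * π else 0 := by
  split_ifs with hj
  · simp [hj]; ring
  · have hj' : (j : ℝ) ≠ 0 := by exact_mod_cast hj
    rw [intervalIntegral.integral_comp_mul_left (fun x => cos x) hj', integral_cos]
    simp [sin_int_mul_pi]

theorem trinom_eq_integral (n : ℕ) (j : ℤ) :
    2 * π * trinom n j = ∫ θ in (-π)..π, (1 + 2 * cos θ) ^ n * cos (j * θ) := by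
  induction n generalizing j with
  | zero =>
    simp only [pow_zero, one_mul]
    rw [integral_cos_int_mul, trinom_zero]
    split_ifs <;> simp
  | succ n ih =>
    have hint : ∀ j : ℤ, IntervalIntegrable (fun θ => (1 + 2 * cos θ) ^ n * cos (j * θ))
        MeasureTheory.volume (-π) π := fun j => by
      apply Continuous.intervalIntegrable
      fun_prop
    rw [trinom_succ, mul_add, mul_add, ih, ih, ih, ← intervalIntegral.integral_add (hint _) (hint _),
      ← intervalIntegral.integral_add ((hint _).add (hint _)) (hint _)]
    refine intervalIntegral.integral_congr fun θ _ => ?_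
    push_cast
    simp only [sub_mul, add_mul, one_mul, cos_sub, cos_add, pow_succ]
    ring

theorem abs_one_add_two_mul_cos_div_le {θ : ℝ} (hθ : |θ| ≤ π) :
    |(1 + 2 * cos θ) / 3| ≤ exp (-(π⁻¹ ^ 2) * θ ^ 2) := by
  have hx : (π⁻¹ ^ 2) * θ ^ 2 ≤ 1 := by
    rw [← mul_pow, ← sq_abs, abs_mul, abs_of_pos (inv_pos.2 pi_pos), inv_mul_eq_div]
    exact pow_le_one₀ (by positivity) ((div_le_one pi_pos).2 hθ)
  have hx0 : 0 ≤ (π⁻¹ ^ 2) * θ ^ 2 := by positivity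
  have h1 := cos_le_one_sub_mul_cos_sq hθ
  have h2 : 2 / π ^ 2 * θ ^ 2 = 2 * ((π⁻¹ ^ 2) * θ ^ 2) := by
    field_simp
  have h3 := neg_one_le_cos θ
  rw [neg_mul]
  have h4 := add_one_le_exp (-((π⁻¹ ^ 2) * θ ^ 2))
  have h5 : 1 / 3 ≤ exp (-((π⁻¹ ^ 2) * θ ^ 2)) := by
    calc (1 : ℝ) / 3 ≤ exp (-1) := by
          rw [exp_neg, one_div]
          exact inv_anti₀ (exp_pos 1) (exp_one_lt_d9.le.trans (by norm_num))
      _ ≤ _ := exp_le_exp.2 (by linarith)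
  rw [abs_le]
  constructor <;> linarith

theorem tendsto_mul_cos_div_sqrt_sub_one (x : ℝ) :
    Tendsto (fun n : ℕ => (n : ℝ) * (cos (x / √n) - 1)) atTop (nhds (-(x ^ 2 / 2))) := by
  have hs : Tendsto (fun n : ℕ => √(n : ℝ)) atTop atTop :=
    tendsto_sqrt_atTop.comp tendsto_natCast_atTop_atTop
  have h0 : Tendsto (fun n : ℕ => |x| ^ 4 * (5 / 96) / (n : ℝ)) atTop (nhds 0) :=
    tendsto_const_nhds.div_atTop tendsto_natCast_atTop_atTop
  rw [← tendsto_sub_nhds_zero_iff]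
  refine squeeze_zero_norm' ?_ h0
  filter_upwards [hs.eventually_ge_atTop |x|, eventually_ge_atTop 1] with n hn hn1
  have hn0 : (0 : ℝ) < n := by exact_mod_cast hn1
  have hs0 : 0 < √(n : ℝ) := sqrt_pos.2 hn0
  have hs2 : √(n : ℝ) ^ 2 = n := sq_sqrt hn0.le
  have hb := cos_bound (x := x / √n) (by
    rw [abs_div, abs_of_pos hs0]; exact (div_le_one hs0).2 hn)
  have he : (n : ℝ) * (cos (x / √n) - 1) - -(x ^ 2 / 2) =
      n * (cos (x / √n) - (1 - (x / √n) ^ 2 / 2)) := by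
    rw [div_pow, hs2]
    field_simp
    ring
  rw [he, Real.norm_eq_abs, abs_mul, abs_of_pos hn0]
  calc _ ≤ (n : ℝ) * (|x / √n| ^ 4 * (5 / 96)) := by gcongr
    _ = _ := by
      rw [abs_div, abs_of_pos hs0, div_pow, show √(n : ℝ) ^ 4 = (√(n : ℝ) ^ 2) ^ 2 by ring, hs2]
      field_simp

/-- The local limit theorem for trinomial coefficients with fixed index. -/
theorem tendsto_sqrt_mul_trinom (j : ℤ) :
    Tendsto (fun n : ℕ => √n * (trinom n j / 3 ^ n)) atTop (nhds (√(3 * π) / (2 * π))) := by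
  set F : ℕ → ℝ → ℝ := fun n => Set.indicator (Set.Ioc (-π * √n) (π * √n))
    fun x => ((1 + 2 * cos (x / √n)) / 3) ^ n * cos (j * (x / √n)) with hF
  have hlim : Tendsto (fun n => ∫ x, F n x) atTop (nhds (∫ x, exp (-(1 / 3) * x ^ 2))) := by
    refine MeasureTheory.tendsto_integral_of_dominated_convergence
      (fun x => exp (-(π⁻¹ ^ 2) * x ^ 2)) (fun n => ?_) (integrable_exp_neg_mul_sq (by positivity))
      (fun n => Eventually.of_forall fun x => ?_) (Eventually.of_forall fun x => ?_)
    · exact (Continuous.aestronglyMeasurable (by fun_prop)).indicator measurableSet_Ioc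
    · simp only [hF, Set.indicator_apply]
      split_ifs with hx
      · rw [Real.norm_eq_abs, abs_mul, abs_pow]
        have hn : 0 < √(n : ℝ) := by
          rw [Set.mem_Ioc] at hx
          by_contra! h
          have : √(n : ℝ) = 0 := le_antisymm h (sqrt_nonneg _)
          simp only [this, mul_zero] at hx
          linarith
        have h1 : |x / √n| ≤ π := by
          rw [abs_div, abs_of_pos hn, div_le_iff₀ hn, abs_le]
          exact ⟨by linarith [hx.1], hx.2⟩
        calc _ ≤ exp (-(π⁻¹ ^ 2) * (x / √n) ^ 2) ^ n * 1 := by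
              gcongr
              · exact abs_one_add_two_mul_cos_div_le h1
              · exact abs_cos_le_one _
          _ = _ := by
            rw [mul_one, ← exp_nat_mul, div_pow, sq_sqrt (Nat.cast_nonneg n)]
            have : (n : ℝ) ≠ 0 := (sqrt_pos.1 hn).ne'
            congr 1
            field_simp
      · rw [norm_zero]
        positivity
    · have hs : Tendsto (fun n : ℕ => √(n : ℝ)) atTop atTop :=
        tendsto_sqrt_atTop.comp tendsto_natCast_atTop_atTop
      have h1 : Tendsto (fun n : ℕ => ((1 + 2 * cos (x / √n)) / 3) ^ n) atTop
          (nhds (exp (-(1 / 3) * x ^ 2))) := by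
        have := Real.tendsto_one_add_pow_exp_of_tendsto
          (g := fun n : ℕ => 2 / 3 * (cos (x / √n) - 1)) (t := -(1 / 3) * x ^ 2) (by
            have := (tendsto_mul_cos_div_sqrt_sub_one x).const_mul (2 / 3)
            convert this using 2 <;> ring)
        refine this.congr fun n => ?_
        congr 1
        ring
      have h2 : Tendsto (fun n : ℕ => cos (j * (x / √n))) atTop (nhds 1) := by
        have h3 : Tendsto (fun n : ℕ => (j : ℝ) * (x / √n)) atTop (nhds 0) := by
          simpa using (tendsto_const_nhds.div_atTop hs).const_mul (j : ℝ)
        have h4 := (continuous_cos.tendsto 0).comp h3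
        rwa [cos_zero] at h4
      have h4 := h1.mul h2
      rw [mul_one] at h4
      refine h4.congr' ?_
      filter_upwards [hs.eventually_gt_atTop |x|] with n hn
      have hx := abs_lt.1 hn
      have hp : 1 < π := by linarith [pi_gt_three]
      simp only [hF]
      rw [Set.indicator_of_mem]
      constructor <;> nlinarith [abs_nonneg x]
  rw [integral_gaussian] at hlim
  have hlim' := hlim.div_const (2 * π)
  rw [show π / (1 / 3) = 3 * π by ring] at hlim'
  refine hlim'.congr' ?_
  filter_upwards [eventually_ge_atTop 1] with n hn
  have hn0 : (0 : ℝ) < n := by exact_mod_cast hn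
  have hs0 : 0 < √(n : ℝ) := sqrt_pos.2 hn0
  rw [div_eq_iff (by positivity), hF]
  simp only
  rw [MeasureTheory.integral_indicator measurableSet_Ioc,
    ← intervalIntegral.integral_of_le (by nlinarith [pi_pos]),
    intervalIntegral.integral_comp_div
      (fun θ => ((1 + 2 * cos θ) / 3) ^ n * cos (j * θ)) hs0.ne',
    mul_div_cancel_right₀ _ hs0.ne', mul_div_cancel_right₀ _ hs0.ne', smul_eq_mul]
  have h5 : ∀ θ : ℝ, ((1 + 2 * cos θ) / 3) ^ n * cos (j * θ) =
      ((1 + 2 * cos θ) ^ n * cos (j * θ)) * (3 ^ n)⁻¹ := fun θ => by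
    rw [div_pow]; ring
  simp only [h5]
  rw [intervalIntegral.integral_mul_const, ← trinom_eq_integral]
  ring

theorem tendsto_trinom_div (j : ℤ) :
    Tendsto (fun n : ℕ => trinom n j / 3 ^ n) atTop (nhds 0) := by
  have hs : Tendsto (fun n : ℕ => √(n : ℝ)) atTop atTop :=
    tendsto_sqrt_atTop.comp tendsto_natCast_atTop_atTop
  refine ((tendsto_sqrt_mul_trinom j).div_atTop hs).congr' ?_
  filter_upwards [hs.eventually_gt_atTop 0] with n hn
  field_simp

theorem hasSum_trinom (n : ℕ) : HasSum (trinom n) (3 ^ n) := by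
  induction n with
  | zero => simpa [funext trinom_zero] using hasSum_ite_eq (0 : ℤ) (1 : ℝ)
  | succ n ih =>
    have h1 := (Equiv.subRight (1 : ℤ)).hasSum_iff.2 ih
    have h2 := (Equiv.addRight (1 : ℤ)).hasSum_iff.2 ih
    convert (h1.add ih).add h2 using 1
    · funext j
      exact trinom_succ n j
    · ring

theorem hasSum_mul_trinom (n : ℕ) : HasSum (fun j : ℤ => j * trinom n j) 0 := by
  induction n with
  | zero =>
    convert hasSum_zero (α := ℝ) (β := ℤ) using 1
    funext j
    rw [trinom_zero]
    split_ifs with h <;> simp [h]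
  | succ n ih =>
    have h0 := hasSum_trinom n
    have h1 := (Equiv.subRight (1 : ℤ)).hasSum_iff.2 (ih.add h0)
    have h2 := (Equiv.addRight (1 : ℤ)).hasSum_iff.2 (ih.sub h0)
    convert (h1.add ih).add h2 using 1
    · funext j
      simp [trinom_succ]
      ring
    · ring

theorem hasSum_sq_mul_trinom (n : ℕ) :
    HasSum (fun j : ℤ => (j : ℝ) ^ 2 * trinom n j) (2 / 3 * n * 3 ^ n) := by
  induction n with
  | zero =>
    convert hasSum_zero (α := ℝ) (β := ℤ) using 1
    · funext j
      rw [trinom_zero]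
      split_ifs with h <;> simp [h]
    · simp
  | succ n ih =>
    have h0 := hasSum_trinom n
    have h' := hasSum_mul_trinom n
    have h1 := (Equiv.subRight (1 : ℤ)).hasSum_iff.2 ((ih.add (h'.mul_left 2)).add h0)
    have h2 := (Equiv.addRight (1 : ℤ)).hasSum_iff.2 ((ih.sub (h'.mul_left 2)).add h0)
    convert (h1.add ih).add h2 using 1
    · funext j
      simp [trinom_succ]
      ring
    · push_cast
      ring

theorem two_mul_sum_range_trinom {n L : ℕ} (hL : n < L) :
    2 * ∑ k ∈ Finset.range L, trinom n k = 3 ^ n + trinom n 0 := by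
  have h1 := (hasSum_trinom n).nat_add_neg
  have h2 : HasSum (fun k : ℕ => trinom n k + trinom n (-k))
      (∑ k ∈ Finset.range L, (trinom n k + trinom n (-k))) := by
    refine hasSum_sum_of_ne_finset_zero fun k hk => ?_
    rw [Finset.mem_range] at hk
    rw [trinom_neg, trinom_eq_zero (by grind), add_zero]
  rw [h1.unique h2, Finset.mul_sum]
  refine Finset.sum_congr rfl fun k _ => ?_
  rw [trinom_neg]
  ring

theorem sum_range_shift_le_of_hasSum {f : ℤ → ℝ} {a : ℝ} (hf : ∀ j, 0 ≤ f j) (h : HasSum f a)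
    (c : ℤ) (L : ℕ) : ∑ k ∈ Finset.range L, f (k + c) ≤ a := by
  have hinj : Function.Injective fun k : ℕ => (k : ℤ) + c := fun a b hab => by
    simpa using hab
  have := sum_le_hasSum ((Finset.range L).image fun k : ℕ => (k : ℤ) + c) (fun j _ => hf j) h
  rwa [Finset.sum_image hinj.injOn] at this

theorem sum_mul_sub_succ (a f : ℕ → ℝ) (L : ℕ) :
    ∑ k ∈ Finset.range L, a (k + 1) * (f k - f (k + 1)) =
      ∑ k ∈ Finset.range L, (a (k + 1) - a k) * f k + a 0 * f 0 - a L * f L := by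
  induction L with
  | zero => simp
  | succ L ih => rw [Finset.sum_range_succ, Finset.sum_range_succ, ih]; ring

/-- The difference `k t(N, k) - (k + 2) t(N, k + 2)` of weighted trinomial coefficients. -/
noncomputable def trinomDiff (N k : ℕ) : ℝ :=
  k * trinom N k - (k + 2) * trinom N (k + 2)

theorem succ_mul_trinomDiff (N k : ℕ) :
    ((N : ℝ) + 1) * trinomDiff N k = ((k : ℝ) + 1) ^ 2 * trinom (N + 1) (k + 1) -
      (N + 1) * (trinom N k + trinom N (k + 2)) := by
  have h := mul_trinom_succ N (k + 1)
  rw [add_sub_cancel_right, add_assoc] at h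
  norm_num at h
  rw [trinomDiff]
  linear_combination (-(k : ℝ) - 1) * h

theorem abs_trinomDiff_sub_le (N k : ℕ) :
    |trinomDiff N k - trinomDiff N (k + 1)| ≤
      (((k : ℝ) + 1) ^ 2 * (trinom (N + 1) (k + 1) - trinom (N + 1) (k + 2)) +
        (2 * k + 3) * trinom (N + 1) (k + 2)) / (N + 1) +
      (trinom N k - trinom N (k + 1)) + (trinom N (k + 2) - trinom N (k + 3)) := by
  have h0 := succ_mul_trinomDiff N k
  have h1 := succ_mul_trinomDiff N (k + 1)
  push_cast at h1
  rw [show (k : ℤ) + 1 + 1 = k + 2 by ring, show (k : ℤ) + 1 + 2 = k + 3 by ring] at h1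
  have hk : (0 : ℤ) ≤ k := Int.natCast_nonneg k
  have m1 := trinom_add_one_le (N + 1) (j := k + 1) (by omega)
  have m2 := trinom_add_one_le N hk
  have m3 := trinom_add_one_le N (j := k + 2) (by omega)
  rw [show (k : ℤ) + 1 + 1 = k + 2 by ring] at m1
  rw [show (k : ℤ) + 2 + 1 = k + 3 by ring] at m3
  have p1 := trinom_nonneg (N + 1) (k + 2)
  have hN : (0 : ℝ) < N + 1 := by positivity
  have he : trinomDiff N k - trinomDiff N (k + 1) =
      (((k : ℝ) + 1) ^ 2 * (trinom (N + 1) (k + 1) - trinom (N + 1) (k + 2)) -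
        (2 * k + 3) * trinom (N + 1) (k + 2)) / (N + 1) -
      (trinom N k - trinom N (k + 1)) - (trinom N (k + 2) - trinom N (k + 3)) := by
    field_simp
    linear_combination h0 - h1
  have q1 : 0 ≤ ((k : ℝ) + 1) ^ 2 * (trinom (N + 1) (k + 1) - trinom (N + 1) (k + 2)) / (N + 1) :=
    div_nonneg (mul_nonneg (by positivity) (by linarith)) hN.le
  have q2 : 0 ≤ (2 * (k : ℝ) + 3) * trinom (N + 1) (k + 2) / (N + 1) := by positivity
  rw [he, abs_le, sub_div, add_div]
  constructor <;> linarith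

theorem sum_mul_abs_trinomDiff_sub_le (N L : ℕ) :
    ∑ k ∈ Finset.range L, ((k : ℝ) + 1) * |trinomDiff N k - trinomDiff N (k + 1)| ≤
      (12 * 3 ^ N : ℝ) := by
  have hN : (0 : ℝ) < N + 1 := by positivity
  have hS : ∀ c : ℤ, ∑ k ∈ Finset.range L, (((k + c : ℤ) : ℝ)) ^ 2 * trinom (N + 1) (k + c) ≤
      ((N : ℝ) + 1) * (2 * 3 ^ N) := fun c => by
    refine (sum_range_shift_le_of_hasSum (fun j => mul_nonneg (by positivity) (trinom_nonneg _ j))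
      (hasSum_sq_mul_trinom (N + 1)) c L).trans (le_of_eq ?_)
    push_cast
    ring
  have hT : ∀ c : ℤ, ∑ k ∈ Finset.range L, trinom N (k + c) ≤ (3 : ℝ) ^ N := fun c =>
    sum_range_shift_le_of_hasSum (trinom_nonneg N) (hasSum_trinom N) c L
  have b1 : ∑ k ∈ Finset.range L, ((k : ℝ) + 1) ^ 3 *
      (trinom (N + 1) (k + 1) - trinom (N + 1) (k + 2)) ≤ 3 * (((N : ℝ) + 1) * (2 * 3 ^ N)) := by
    have h := sum_mul_sub_succ (fun k => (k : ℝ) ^ 3) (fun k => trinom (N + 1) (k + 1)) L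
    have h3 : ∑ k ∈ Finset.range L, ((((k : ℕ) + 1 : ℕ) : ℝ) ^ 3 - (k : ℝ) ^ 3) *
        trinom (N + 1) (k + 1) ≤ 3 * (((N : ℝ) + 1) * (2 * 3 ^ N)) := by
      refine le_trans ?_ (mul_le_mul_of_nonneg_left (hS 1) (by norm_num))
      rw [Finset.mul_sum]
      refine Finset.sum_le_sum fun k _ => ?_
      rw [← mul_assoc]
      refine mul_le_mul_of_nonneg_right ?_ (trinom_nonneg _ _)
      push_cast
      have : (0 : ℝ) ≤ k := Nat.cast_nonneg k
      nlinarith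
    have h4 : 0 ≤ (L : ℝ) ^ 3 * trinom (N + 1) (L + 1) :=
      mul_nonneg (by positivity) (trinom_nonneg _ _)
    push_cast at h h3
    simp only [add_assoc, one_add_one_eq_two] at h h3 ⊢
    rw [h]
    linarith
  have b2 : ∑ k ∈ Finset.range L, ((k : ℝ) + 1) * ((2 * k + 3) * trinom (N + 1) (k + 2)) ≤
      2 * (((N : ℝ) + 1) * (2 * 3 ^ N)) := by
    refine le_trans ?_ (mul_le_mul_of_nonneg_left (hS 2) (by norm_num))
    rw [Finset.mul_sum]
    refine Finset.sum_le_sum fun k _ => ?_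
    rw [← mul_assoc, ← mul_assoc]
    refine mul_le_mul_of_nonneg_right ?_ (trinom_nonneg _ _)
    push_cast
    have : (0 : ℝ) ≤ k := Nat.cast_nonneg k
    nlinarith
  have b3 : ∀ c : ℕ, ∑ k ∈ Finset.range L, ((k : ℝ) + 1) *
      (trinom N (k + c) - trinom N (k + c + 1)) ≤ (3 : ℝ) ^ N := fun c => by
    have h := sum_mul_sub_succ (fun k => (k : ℝ)) (fun k => trinom N (k + c)) L
    have h4 : 0 ≤ (L : ℝ) * trinom N (L + c) := mul_nonneg (by positivity) (trinom_nonneg _ _)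
    have h5 := hT c
    push_cast at h
    simp only [add_sub_cancel_left, one_mul, zero_mul, add_zero] at h
    have h6 : ∀ k : ℕ, (k : ℤ) + 1 + c = k + c + 1 := fun k => by ring
    simp only [h6] at h
    rw [h]
    linarith
  have b3' := b3 0
  have b3'' := b3 2
  push_cast at b3' b3''
  simp only [add_zero, add_assoc, show (2 : ℤ) + 1 = 3 by norm_num] at b3' b3''
  calc _ ≤ ∑ k ∈ Finset.range L, ((((k : ℝ) + 1) ^ 3 *
          (trinom (N + 1) (k + 1) - trinom (N + 1) (k + 2)) +
          ((k : ℝ) + 1) * ((2 * k + 3) * trinom (N + 1) (k + 2))) / (N + 1) +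
        ((k : ℝ) + 1) * (trinom N k - trinom N (k + 1)) +
        ((k : ℝ) + 1) * (trinom N (k + 2) - trinom N (k + 3))) := by
        refine Finset.sum_le_sum fun k _ => ?_
        refine (mul_le_mul_of_nonneg_left (abs_trinomDiff_sub_le N k) (by positivity)).trans
          (le_of_eq ?_)
        ring
    _ ≤ (3 * (((N : ℝ) + 1) * (2 * 3 ^ N)) + 2 * ((N + 1) * (2 * 3 ^ N))) / (N + 1) +
        3 ^ N + 3 ^ N := by
        rw [Finset.sum_add_distrib, Finset.sum_add_distrib, ← Finset.sum_div,
          Finset.sum_add_distrib]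
        gcongr
    _ = 12 * 3 ^ N := by
        field_simp
        ring

theorem trinomDiff_eq_zero {N k : ℕ} (h : N < k) : trinomDiff N k = 0 := by
  rw [trinomDiff, trinom_eq_zero (by grind), trinom_eq_zero (by grind)]
  ring

theorem sum_trinomDiff (N : ℕ) : ∑ k ∈ Finset.range (N + 1), trinomDiff N k = trinom N 1 := by
  have h := Finset.sum_range_sub' (fun k : ℕ =>
    (k : ℝ) * trinom N k + (k + 1) * trinom N (k + 1)) (N + 1)
  push_cast at h
  rw [trinom_eq_zero (j := (N : ℤ) + 1) (by grind),
    trinom_eq_zero (j := (N : ℤ) + 1 + 1) (by grind)] at h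
  simp only [zero_mul, zero_add, one_mul, mul_zero, sub_zero] at h
  rw [← h]
  refine Finset.sum_congr rfl fun k _ => ?_
  rw [trinomDiff, show (k : ℤ) + 1 + 1 = k + 2 by ring]
  ring

theorem sum_harmonic_mul_trinomDiff (N : ℕ) :
    ∑ k ∈ Finset.range (N + 1), (harmonic k : ℝ) * trinomDiff N k =
      3 ^ N - trinom N 0 - trinom N 1 +
        ∑ k ∈ Finset.range (N + 1), trinom N (k + 2) * (1 / ((k : ℝ) + 1)) := by
  have h := Finset.sum_range_sub' (fun k : ℕ =>
    (harmonic k : ℝ) * (k * trinom N k) +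
      (harmonic (k + 1) : ℝ) * ((k + 1) * trinom N (k + 1))) (N + 1)
  push_cast at h
  rw [trinom_eq_zero (j := (N : ℤ) + 1) (by grind),
    trinom_eq_zero (j := (N : ℤ) + 1 + 1) (by grind)] at h
  simp only [zero_mul, zero_add, one_mul, mul_zero, sub_zero, Rat.cast_one,
    show harmonic 1 = 1 by simp [harmonic]] at h
  have h2 := two_mul_sum_range_trinom (n := N) (L := N + 1 + 2) (by omega)
  rw [Finset.sum_range_succ', Finset.sum_range_succ'] at h2
  push_cast at h2
  simp only [add_assoc, one_add_one_eq_two] at h2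
  have h3 : ∑ k ∈ Finset.range (N + 1), (harmonic k : ℝ) * trinomDiff N k -
      ∑ k ∈ Finset.range (N + 1), trinom N (k + 2) * (1 / ((k : ℝ) + 1)) -
      2 * ∑ k ∈ Finset.range (N + 1), trinom N (k + 2) = trinom N 1 := by
    rw [← h, Finset.mul_sum, ← Finset.sum_sub_distrib, ← Finset.sum_sub_distrib]
    refine Finset.sum_congr rfl fun k _ => ?_
    rw [trinomDiff, show (k : ℤ) + 1 + 1 = k + 2 by ring, harmonic_succ (k + 1), harmonic_succ k]
    push_cast
    have : (k : ℝ) + 1 + 1 ≠ 0 := by positivity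
    field_simp
    ring
  linarith

theorem sum_divisorRemainder_mul_trinomDiff (N : ℕ) :
    ∑ k ∈ Finset.range (N + 1),
      (divisorRemainder (k + 1) - divisorRemainder k) * trinomDiff N k =
      ∑ k ∈ Finset.range (N + 1), (k + 1) * (trinomDiff N k - trinomDiff N (k + 1)) *
        (divisorRemainder (k + 1) / (k + 1 : ℕ)) := by
  have h := sum_mul_sub_succ divisorRemainder (trinomDiff N) (N + 1)
  rw [trinomDiff_eq_zero (Nat.lt_succ_self N), show divisorRemainder 0 = 0 by
    simp [divisorRemainder], zero_mul, mul_zero, add_zero, sub_zero] at h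
  rw [← h]
  refine Finset.sum_congr rfl fun k _ => ?_
  push_cast
  field_simp

theorem tendsto_sum_divisors_mul_trinomDiff :
    Tendsto (fun N : ℕ => (∑ k ∈ Finset.range (N + 1),
      ((Nat.divisors (k + 1)).card : ℝ) * trinomDiff N k) / 3 ^ N) atTop (nhds 1) := by
  have hA : Tendsto (fun N : ℕ => ∑ k ∈ Finset.range (N + 1),
      (trinom N (k + 2) / 3 ^ N) * (1 / ((k : ℝ) + 1))) atTop (nhds 0) := by
    refine tendsto_sum_mul_of_tendsto_zero (W := fun N k => trinom N (k + 2) / 3 ^ N)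
      (L := fun N => N + 1) (C := 1) (fun N => ?_)
      (fun k => tendsto_trinom_div _) tendsto_one_div_add_atTop_nhds_zero_nat
    have h1 : ∀ k ∈ Finset.range (N + 1), |trinom N (k + 2) / 3 ^ N| =
        trinom N (k + 2) / 3 ^ N := fun k _ =>
      abs_of_nonneg (div_nonneg (trinom_nonneg _ _) (by positivity))
    rw [Finset.sum_congr rfl h1, ← Finset.sum_div]
    exact div_le_one_of_le₀
      (sum_range_shift_le_of_hasSum (trinom_nonneg N) (hasSum_trinom N) 2 _) (by positivity)
  have hB : Tendsto (fun N : ℕ => ∑ k ∈ Finset.range (N + 1),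
      ((k + 1) * (trinomDiff N k - trinomDiff N (k + 1)) / 3 ^ N) *
        (divisorRemainder (k + 1) / (k + 1 : ℕ))) atTop (nhds 0) := by
    have hq : ∀ k, Tendsto (fun N => trinomDiff N k / 3 ^ N) atTop (nhds 0) := fun k => by
      have := ((tendsto_trinom_div k).const_mul (k : ℝ)).sub
        ((tendsto_trinom_div (k + 2)).const_mul ((k : ℝ) + 2))
      simp only [mul_zero, sub_zero] at this
      refine this.congr fun N => ?_
      rw [trinomDiff]
      ring
    refine tendsto_sum_mul_of_tendsto_zero
      (W := fun N k => (k + 1) * (trinomDiff N k - trinomDiff N (k + 1)) / 3 ^ N)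
      (u := fun k => divisorRemainder (k + 1) / (k + 1 : ℕ))
      (L := fun N => N + 1) (C := 12) (fun N => ?_) (fun k => ?_)
      (tendsto_divisorRemainder_div.comp (tendsto_add_atTop_nat 1))
    · have h1 : ∀ k ∈ Finset.range (N + 1),
          |((k : ℝ) + 1) * (trinomDiff N k - trinomDiff N (k + 1)) / 3 ^ N| =
          ((k : ℝ) + 1) * |trinomDiff N k - trinomDiff N (k + 1)| / 3 ^ N := fun k _ => by
        rw [abs_div, abs_mul, abs_of_pos (show (0 : ℝ) < k + 1 by positivity),
          abs_of_pos (show (0 : ℝ) < 3 ^ N by positivity)]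
      rw [Finset.sum_congr rfl h1, ← Finset.sum_div, div_le_iff₀ (by positivity)]
      exact sum_mul_abs_trinomDiff_sub_le N _
    · have := ((hq k).sub (hq (k + 1))).const_mul ((k : ℝ) + 1)
      simp only [mul_zero, sub_zero] at this
      refine this.congr fun N => ?_
      ring
  have h0 := tendsto_trinom_div 0
  have h1 := tendsto_trinom_div 1
  have hsum := (((h0.const_sub 1).sub h1).add (h1.const_mul eulerMascheroniConstant)).add
    (hA.add hB)
  simp only [mul_zero, sub_zero, add_zero] at hsum
  refine hsum.congr fun N => ?_
  have hd : ∑ k ∈ Finset.range (N + 1), ((Nat.divisors (k + 1)).card : ℝ) * trinomDiff N k =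
      ∑ k ∈ Finset.range (N + 1), (harmonic k : ℝ) * trinomDiff N k +
      eulerMascheroniConstant * ∑ k ∈ Finset.range (N + 1), trinomDiff N k +
      ∑ k ∈ Finset.range (N + 1),
        (divisorRemainder (k + 1) - divisorRemainder k) * trinomDiff N k := by
    rw [Finset.mul_sum, ← Finset.sum_add_distrib, ← Finset.sum_add_distrib]
    refine Finset.sum_congr rfl fun k _ => ?_
    rw [card_divisors_eq]
    ring
  rw [hd, sum_harmonic_mul_trinomDiff, sum_trinomDiff, sum_divisorRemainder_mul_trinomDiff]
  simp only [div_mul_eq_mul_div, ← Finset.sum_div]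
  field_simp
  ring

theorem tendsto_succ_mul_K_div :
    Tendsto (fun n : ℕ => ((n : ℝ) + 1) * K n / 3 ^ (n + 1)) atTop (nhds 1) := by
  have h := (tendsto_sum_divisors_mul_trinomDiff.sub ((tendsto_trinom_div 1).const_mul 2)).comp
    (tendsto_add_atTop_nat 1)
  rw [mul_zero, sub_zero] at h
  refine h.congr fun n => ?_
  rw [succ_mul_K, Function.comp_apply, sub_div, mul_div_assoc]
  rfl

theorem tendsto_sqrt_mul_succ_mul_o_div :
    Tendsto (fun n : ℕ => ((n : ℝ) + 1) * (o n * √n) / 3 ^ (n + 1)) atTop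
      (nhds (√(3 * π) / (2 * π))) := by
  have h1 := (tendsto_sqrt_mul_trinom 1).comp (tendsto_add_atTop_nat 1)
  have h2 : Tendsto (fun n : ℕ => √((n : ℝ) / (n + 1))) atTop (nhds 1) := by
    simpa using (tendsto_natCast_div_add_atTop (1 : ℝ)).sqrt
  have h := h1.mul h2
  rw [mul_one] at h
  refine h.congr fun n => ?_
  have hn : √((n : ℝ) + 1) ≠ 0 := by positivity
  rw [Function.comp_apply, ← succ_mul_o, sqrt_div (Nat.cast_nonneg n)]
  push_cast
  field_simp

theorem open_deutsch_average_height :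
    Tendsto (fun n : ℕ => (K n : ℝ) / ((o n : ℝ) * Real.sqrt n)) atTop
      (nhds (2 * Real.sqrt (Real.pi / 3))) := by
  have h := tendsto_succ_mul_K_div.div tendsto_sqrt_mul_succ_mul_o_div (by positivity)
  have hlim : 1 / (√(3 * π) / (2 * π)) = 2 * √(π / 3) := by
    have h3 : √(3 * π) * √(π / 3) = π := by
      rw [← sqrt_mul (by positivity), show 3 * π * (π / 3) = π ^ 2 by ring, sqrt_sq pi_pos.le]
    rw [one_div_div, div_eq_iff (by positivity)]
    linear_combination -2 * h3
  rw [hlim] at h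
  refine h.congr fun n => ?_
  rw [Pi.div_apply, div_div_div_cancel_right₀ (by positivity), mul_div_mul_left _ _ (by positivity)]
end
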